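/- arXiv:2001.01533 — 2 statements merged into one kernel-verified Lean document; each statement's English description precedes it below -/
import Mathlib

section
/- Let n ≥ 1 be an integer, and let p, q > 1 be reals, with the additional restriction p, q ≤ n/(n-2) when n ≥ 3. Assume max{(q/2 + 1)/(pq - 1), (2 + 1/p)/(pq - 1)} > (n-1)/2. Let u₀, u₁, v₀, v₁ : ℝⁿ → ℝ be continuous, nonnegative, supported in the closed ball B_R of radius R > 0, with u₀ and v₁ not identically zero. Then there exist constants ε₀ > 0 and C > 0 (depending only on u₀, u₁, v₀, v₁, n, p, q, R) such that for every ε ∈ (0, ε₀] and every T > 0: if (u, v) is a classical solution of the system u_tt - Δu + u_t = |v|^p, v_tt - Δv = |u|^q on [0,T) × ℝⁿ with initial data (u, u_t, v, v_t)(0,·) = ε(u₀, u₁, v₀, v₁) and with supp u, supp v contained in {(t,x) : |x| ≤ R + t}, then T ≤ C ε^{-1/max{F₁(n,p,q), F₂(n,p,q)}}, where F₁(n,p,q) := (2 + 1/p)/(pq - 1) - (n-1)/2 and F₂(n,p,q) := (1 + 2/q)/(pq - 1) - (n-1)/q. -/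
open Real Set

/-- The Laplacian of a function on `ℝⁿ` (Euclidean space), as the sum of the second
partial derivatives in the coordinate directions. -/
noncomputable def laplacian {n : ℕ} (f : EuclideanSpace ℝ (Fin n) → ℝ)
    (x : EuclideanSpace ℝ (Fin n)) : ℝ :=
  ∑ i : Fin n,
    fderiv ℝ (fun y => fderiv ℝ f y (EuclideanSpace.single i 1)) x (EuclideanSpace.single i 1)

/-- `(u, v)` is a classical solution of Nakao's problem
`u_tt - Δu + u_t = |v|^p`, `v_tt - Δv = |u|^q` on `[0, T) × ℝⁿ`:
both components are twice continuously differentiable (jointly in `(t,x)`) and the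
equations hold pointwise for `t ∈ [0, T)`. -/
def IsNakaoSolution {n : ℕ} (p q T : ℝ) (u v : ℝ → EuclideanSpace ℝ (Fin n) → ℝ) : Prop :=
  ContDiff ℝ 2 (fun z : ℝ × EuclideanSpace ℝ (Fin n) => u z.1 z.2) ∧
  ContDiff ℝ 2 (fun z : ℝ × EuclideanSpace ℝ (Fin n) => v z.1 z.2) ∧
  (∀ t ∈ Set.Ico (0:ℝ) T, ∀ x,
    deriv (deriv (fun s => u s x)) t - laplacian (u t) x + deriv (fun s => u s x) t
      = |v t x| ^ p) ∧
  (∀ t ∈ Set.Ico (0:ℝ) T, ∀ x,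
    deriv (deriv (fun s => v s x)) t - laplacian (v t) x = |u t x| ^ q)

open MeasureTheory

/-- Hölder's inequality on a compact set, in a form without roots on the left. -/
lemma setIntegral_mul_rpow_le {X : Type*} [TopologicalSpace X] [MeasurableSpace X] [BorelSpace X]
    [T2Space X] {μ : Measure X} [IsFiniteMeasureOnCompacts μ] {K : Set X} (hK : IsCompact K)
    {f g : X → ℝ} (hf : Continuous f) (hg : Continuous g) (hg0 : ∀ x, 0 ≤ g x)
    {r s : ℝ} (hrs : r.HolderConjugate s) :
    (∫ x in K, |f x| * g x ∂μ) ^ r ≤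
      (∫ x in K, |f x| ^ r ∂μ) * (∫ x in K, g x ^ s ∂μ) ^ (r - 1) := by
  have hm : ∀ (h : X → ℝ), Continuous h → ∀ a : ENNReal, MemLp h a (μ.restrict K) := by
    intro h hh a
    have : IsFiniteMeasure (μ.restrict K) := ⟨by simpa using hK.measure_lt_top⟩
    obtain ⟨C, hC⟩ := hK.exists_bound_of_continuousOn hh.continuousOn
    refine (MemLp.of_bound (p := ⊤)
      (hh.continuousOn.aestronglyMeasurable_of_isCompact hK hK.measurableSet) C ?_).mono_exponent
        le_top
    exact (ae_restrict_iff' hK.measurableSet).2 (Filter.Eventually.of_forall hC)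
  have hr := hrs.pos
  have h := integral_mul_le_Lp_mul_Lq_of_nonneg (μ := μ.restrict K) hrs
    (f := fun x => |f x|) (g := g) (Filter.Eventually.of_forall fun x => abs_nonneg _)
    (Filter.Eventually.of_forall hg0) (hm _ hf.abs _) (hm _ hg _)
  have hA : 0 ≤ ∫ x in K, |f x| ^ r ∂μ := integral_nonneg fun x => by positivity
  have hB : 0 ≤ ∫ x in K, g x ^ s ∂μ := integral_nonneg fun x => Real.rpow_nonneg (hg0 x) _
  have h0 : 0 ≤ ∫ x in K, |f x| * g x ∂μ :=
    integral_nonneg fun x => mul_nonneg (abs_nonneg _) (hg0 x)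
  refine (Real.rpow_le_rpow h0 h hr.le).trans (le_of_eq ?_)
  rw [Real.mul_rpow (by positivity) (by positivity), ← Real.rpow_mul hA, ← Real.rpow_mul hB]
  have e1 : 1 / r * r = 1 := by field_simp
  have e2 : 1 / s * r = r - 1 := by
    have := hrs.sub_one_mul_conj
    have hs := hrs.symm.pos
    field_simp
    linarith
  rw [e1, e2, Real.rpow_one]

/-- Differentiation under the integral sign over a compact set. -/
lemma hasDerivAt_setIntegral_of_continuous_deriv {X : Type*} [TopologicalSpace X]
    [MeasurableSpace X] [BorelSpace X] [T2Space X] {μ : Measure X} [IsFiniteMeasureOnCompacts μ]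
    {K : Set X} (hK : IsCompact K) {F F' : ℝ → X → ℝ} (hF : Continuous F.uncurry)
    (hF' : Continuous F'.uncurry) (h : ∀ t x, HasDerivAt (fun s => F s x) (F' t x) t) (t : ℝ) :
    HasDerivAt (fun s => ∫ x in K, F s x ∂μ) (∫ x in K, F' t x ∂μ) t := by
  have hc : ∀ s, Continuous (F s) := fun s => hF.comp (by fun_prop : Continuous fun x => (s, x))
  have hc' : ∀ s, Continuous (F' s) := fun s => hF'.comp (by fun_prop : Continuous fun x => (s, x))
  obtain ⟨C, hC⟩ :=
    ((isCompact_closedBall t 1).prod hK).exists_bound_of_continuousOn hF'.continuousOn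
  have hae : ∀ s, AEStronglyMeasurable (F s) (μ.restrict K) := fun s =>
    (hc s).continuousOn.aestronglyMeasurable_of_isCompact hK hK.measurableSet
  refine (hasDerivAt_integral_of_dominated_loc_of_deriv_le (bound := fun _ => C)
    (Metric.closedBall_mem_nhds t one_pos) (Filter.Eventually.of_forall hae)
    ((hc t).continuousOn.integrableOn_compact hK)
    ((hc' t).continuousOn.aestronglyMeasurable_of_isCompact hK hK.measurableSet) ?_
    ((continuous_const (y := C)).continuousOn.integrableOn_compact hK)
    (Filter.Eventually.of_forall fun x s _ => h s x)).2
  exact (ae_restrict_iff' hK.measurableSet).2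
    (Filter.Eventually.of_forall fun x hx s hs => hC (s, x) ⟨hs, hx⟩)

/-- Uniform bound for translated discrete Gaussian sums. -/
lemma exists_sum_exp_neg_sq_le {a : ℝ} (ha : 0 < a) :
    ∃ S : ℝ, 0 < S ∧ ∀ (s : ℝ) (N : ℕ),
      ∑ k ∈ Finset.range N, exp (-a * ((k : ℝ) - s) ^ 2) ≤ S := by
  have hsum : Summable fun j : ℤ => exp a * exp (-(a / 2) * |(j : ℝ)|) := by
    refine Summable.mul_left _ (Summable.of_nat_of_neg ?_ ?_)
    all_goals
      simp only [Int.cast_neg, Int.cast_natCast, abs_neg, Nat.abs_cast]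
      exact (Real.summable_exp_nat_mul_iff.2 (by linarith : -(a / 2) < 0)).congr fun n => by
        congr 1; ring
  refine ⟨∑' j : ℤ, exp a * exp (-(a / 2) * |(j : ℝ)|), ?_, fun s N => ?_⟩
  · exact hsum.tsum_pos (fun _ => by positivity) 0 (by positivity)
  let e : ℕ ↪ ℤ := ⟨fun k => (k : ℤ) - ⌊s⌋, fun k l h => by simpa using h⟩
  calc _ ≤ ∑ k ∈ Finset.range N, exp a * exp (-(a / 2) * |((e k : ℤ) : ℝ)|) := by
        refine Finset.sum_le_sum fun k _ => ?_
        rw [← exp_add]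
        refine exp_le_exp.2 ?_
        have h1 := Int.floor_le s
        have h2 := Int.lt_floor_add_one s
        have hek : ((e k : ℤ) : ℝ) = k - ⌊s⌋ := Int.cast_sub _ _
        rw [hek]
        suffices |(k : ℝ) - ⌊s⌋| / 2 ≤ ((k : ℝ) - s) ^ 2 + 1 by nlinarith
        have h3 : |(k : ℝ) - ⌊s⌋| ≤ |(k : ℝ) - s| + 1 := by
          have : (k : ℝ) - ⌊s⌋ = (k - s) + (s - ⌊s⌋) := by ring
          rw [this]
          refine (abs_add_le _ _).trans ?_
          gcongr
          rw [abs_of_nonneg] <;> linarith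
        rw [← sq_abs]
        nlinarith [sq_nonneg (|(k : ℝ) - s| - 1 / 4)]
    _ = ∑ j ∈ (Finset.range N).map e, exp a * exp (-(a / 2) * |(j : ℝ)|) := by
        rw [Finset.sum_map]
    _ ≤ _ := hsum.sum_le_tsum _ fun _ _ => by positivity

section Moment

variable {n : ℕ}

local notation "𝔼" => EuclideanSpace ℝ (Fin n)

lemma hasFDerivAt_exp_inner (ω x : 𝔼) :
    HasFDerivAt (fun y : 𝔼 => exp (inner ℝ ω y)) (exp (inner ℝ ω x) • innerSL ℝ ω) x :=
  ((innerSL ℝ ω).hasFDerivAt (x := x)).exp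

lemma integral_fderiv_mul_exp_inner {f : 𝔼 → ℝ} (hf : ContDiff ℝ 1 f) (hc : HasCompactSupport f)
    (ω e : 𝔼) :
    ∫ x, fderiv ℝ f x e * exp (inner ℝ ω x) = -inner ℝ ω e * ∫ x, f x * exp (inner ℝ ω x) := by
  have hexp : Continuous fun x : 𝔼 => exp (inner ℝ ω x) := by fun_prop
  have hd : ∀ x, fderiv ℝ (fun y : 𝔼 => exp (inner ℝ ω y)) x e
      = inner ℝ ω e * exp (inner ℝ ω x) := fun x => by
    rw [(hasFDerivAt_exp_inner ω x).fderiv]; simp [mul_comm]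
  have hf' : Continuous fun x => fderiv ℝ f x e :=
    (hf.continuous_fderiv one_ne_zero).clm_apply continuous_const
  have hcf' : HasCompactSupport fun x => fderiv ℝ f x e := hc.fderiv_apply ℝ e
  have h := integral_mul_fderiv_eq_neg_fderiv_mul_of_integrable (μ := volume) (f := f)
    (g := fun x : 𝔼 => exp (inner ℝ ω x)) (v := e)
    ((hf'.mul hexp).integrable_of_hasCompactSupport hcf'.mul_right)
    (by
      simp only [hd]
      exact (hf.continuous.mul (continuous_const.mul hexp)).integrable_of_hasCompactSupport
        hc.mul_right)
    ((hf.continuous.mul hexp).integrable_of_hasCompactSupport hc.mul_right)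
    (fun x _ => hf.differentiable one_ne_zero x)
    (fun x _ => (hasFDerivAt_exp_inner ω x).differentiableAt)
  simp only [hd] at h
  rw [← neg_eq_iff_eq_neg] at h
  rw [← h, neg_mul, ← integral_const_mul]
  congr 2
  ext x; ring

lemma integral_laplacian_mul_exp_inner {f : 𝔼 → ℝ} (hf : ContDiff ℝ 2 f)
    (hc : HasCompactSupport f) (ω : 𝔼) :
    ∫ x, laplacian f x * exp (inner ℝ ω x) = ‖ω‖ ^ 2 * ∫ x, f x * exp (inner ℝ ω x) := by
  have hd : ∀ i, ContDiff ℝ 1 fun y => fderiv ℝ f y (EuclideanSpace.single i 1) := fun i =>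
    (hf.fderiv_right (m := 1) (by norm_num)).clm_apply contDiff_const
  have hcd : ∀ i, HasCompactSupport fun y => fderiv ℝ f y (EuclideanSpace.single i 1) := fun i =>
    hc.fderiv_apply ℝ _
  simp only [laplacian, Finset.sum_mul]
  rw [integral_finsetSum]
  · simp only [integral_fderiv_mul_exp_inner (hd _) (hcd _),
      integral_fderiv_mul_exp_inner (hf.of_le one_le_two) hc]
    rw [EuclideanSpace.norm_sq_eq, Finset.sum_mul]
    refine Finset.sum_congr rfl fun i _ => ?_
    simp [EuclideanSpace.inner_single_right]
    ring
  · intro i _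
    refine Continuous.integrable_of_hasCompactSupport (.mul ?_ (by fun_prop)) ?_
    · exact ((hd i).continuous_fderiv one_ne_zero).clm_apply continuous_const
    · exact ((hcd i).fderiv_apply ℝ _).mul_right

lemma hasDerivAt_time {X : Type*} [NormedAddCommGroup X] [NormedSpace ℝ X] {w : ℝ → X → ℝ}
    {k : ℕ} (hw : ContDiff ℝ (k + 1) fun z : ℝ × X => w z.1 z.2) (t : ℝ) (x : X) :
    HasDerivAt (fun s => w s x) (deriv (fun s => w s x) t) t := by
  have : ContDiff ℝ (k + 1) fun s => w s x :=
    hw.comp (by fun_prop : ContDiff ℝ (k + 1) fun s : ℝ => (s, x))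
  exact (this.differentiable (by norm_cast) t).hasDerivAt

lemma contDiff_deriv_time {X : Type*} [NormedAddCommGroup X] [NormedSpace ℝ X] {w : ℝ → X → ℝ}
    {k : ℕ} (hw : ContDiff ℝ (k + 1) fun z : ℝ × X => w z.1 z.2) :
    ContDiff ℝ k fun z : ℝ × X => deriv (fun s => w s z.2) z.1 := by
  have h : (fun z : ℝ × X => deriv (fun s => w s z.2) z.1)
      = fun z => fderiv ℝ (fun z : ℝ × X => w z.1 z.2) z (1, 0) := by
    ext z
    have h1 : HasFDerivAt (fun z : ℝ × X => w z.1 z.2) _ (z.1, z.2) :=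
      (hw.differentiable (by norm_cast) z).hasFDerivAt
    have h2 : HasDerivAt (fun s : ℝ => (s, z.2)) ((1 : ℝ), (0 : X)) z.1 :=
      (hasDerivAt_id z.1).prodMk (hasDerivAt_const _ _)
    exact (h1.comp_hasDerivAt z.1 h2).deriv
  rw [h]
  exact (hw.fderiv_right le_rfl).clm_apply contDiff_const

/-- The exponential moment of `w` in the direction `ω`, over a set `K`. -/
noncomputable def expMoment (K : Set 𝔼) (ω : 𝔼) (w : ℝ → 𝔼 → ℝ) (t : ℝ) : ℝ :=
  ∫ x in K, w t x * exp (inner ℝ ω x)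

lemma hasDerivAt_expMoment {K : Set 𝔼} (hK : IsCompact K) (ω : 𝔼) {w : ℝ → 𝔼 → ℝ}
    {k : ℕ} (hw : ContDiff ℝ (k + 1) fun z : ℝ × 𝔼 => w z.1 z.2) (t : ℝ) :
    HasDerivAt (expMoment K ω w) (expMoment K ω (fun t x => deriv (fun s => w s x) t) t) t := by
  have h1 : Continuous fun z : ℝ × 𝔼 => w z.1 z.2 := hw.continuous
  have h2 := (contDiff_deriv_time hw).continuous
  exact hasDerivAt_setIntegral_of_continuous_deriv hK
    (F := fun t x => w t x * exp (inner ℝ ω x))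
    (F' := fun t x => deriv (fun s => w s x) t * exp (inner ℝ ω x))
    (by unfold Function.uncurry; fun_prop) (h2.mul (by fun_prop))
    (fun t x => (hasDerivAt_time hw t x).mul_const _) t

lemma continuous_expMoment {K : Set 𝔼} (hK : IsCompact K) (ω : 𝔼) {w : ℝ → 𝔼 → ℝ}
    (hw : Continuous fun z : ℝ × 𝔼 => w z.1 z.2) : Continuous (expMoment K ω w) :=
  continuous_parametric_integral_of_continuous
    (f := fun t x => w t x * exp (inner ℝ ω x)) (hw.mul (by fun_prop)) hK

/-- The second-order ordinary differential equation satisfied by the exponential moments of a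
solution of `w_tt - Δw + b w_t = f` with finite propagation speed. -/
lemma expMoment_deriv_deriv {b R T : ℝ} {w f : ℝ → 𝔼 → ℝ}
    (hw : ContDiff ℝ 2 fun z : ℝ × 𝔼 => w z.1 z.2)
    (hf : Continuous fun z : ℝ × 𝔼 => f z.1 z.2)
    (heq : ∀ t ∈ Set.Ico (0:ℝ) T, ∀ x, deriv (deriv (fun s => w s x)) t - laplacian (w t) x
      + b * deriv (fun s => w s x) t = f t x)
    (hsupp : ∀ t ∈ Set.Ico (0:ℝ) T, ∀ x, R + t < ‖x‖ → w t x = 0) (ω : 𝔼)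
    {t : ℝ} (ht : t ∈ Set.Ico (0:ℝ) T) :
    expMoment (Metric.closedBall 0 (R + T)) ω (fun t x => deriv (deriv (fun s => w s x)) t) t
      + b * expMoment (Metric.closedBall 0 (R + T)) ω (fun t x => deriv (fun s => w s x) t) t
      = ‖ω‖ ^ 2 * expMoment (Metric.closedBall 0 (R + T)) ω w t
      + expMoment (Metric.closedBall 0 (R + T)) ω f t := by
  have hK := isCompact_closedBall (0 : 𝔼) (R + T)
  have hwt : ContDiff ℝ 2 (w t) := hw.comp (by fun_prop : ContDiff ℝ 2 fun x : 𝔼 => (t, x))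
  have hz : ∀ x ∉ Metric.closedBall (0 : 𝔼) (R + t), w t x = 0 := fun x hx =>
    hsupp t ht x (by simpa using hx)
  have hc : HasCompactSupport (w t) := .intro (isCompact_closedBall (0 : 𝔼) (R + t)) hz
  have hts : tsupport (w t) ⊆ Metric.closedBall (0 : 𝔼) (R + T) := by
    refine (closure_minimal ?_ Metric.isClosed_closedBall).trans
      (Metric.closedBall_subset_closedBall (by linarith [ht.2] : R + t ≤ R + T))
    intro x hx
    by_contra h
    exact hx (hz x h)
  have hlap : ∀ x ∉ Metric.closedBall (0 : 𝔼) (R + T), laplacian (w t) x = 0 := by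
    intro x hx
    refine Finset.sum_eq_zero fun i _ => ?_
    have h1 : x ∉ tsupport (fun y => fderiv ℝ (w t) y (EuclideanSpace.single i 1)) := fun h =>
      hx (hts (tsupport_fderiv_apply_subset ℝ _ h))
    have h2 := fun h => h1 (tsupport_fderiv_apply_subset ℝ (EuclideanSpace.single i 1) h)
    exact image_eq_zero_of_notMem_tsupport (f := fun x => fderiv ℝ (fun y =>
      fderiv ℝ (w t) y (EuclideanSpace.single i 1)) x (EuclideanSpace.single i 1)) h2
  have hIBP := integral_laplacian_mul_exp_inner hwt hc ω
  rw [← setIntegral_eq_integral_of_forall_compl_eq_zero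
      (s := Metric.closedBall (0 : 𝔼) (R + T)) fun x hx => by rw [hlap x hx, zero_mul],
    ← setIntegral_eq_integral_of_forall_compl_eq_zero
      (s := Metric.closedBall (0 : 𝔼) (R + T)) (f := fun x => w t x * exp (inner ℝ ω x))
      fun x hx => by rw [image_eq_zero_of_notMem_tsupport (fun h => hx (hts h)), zero_mul]]
    at hIBP
  have hw1 : ContDiff ℝ 1 fun z : ℝ × 𝔼 => deriv (fun s => w s z.2) z.1 :=
    contDiff_deriv_time (k := 1) (by exact_mod_cast hw)
  have hw2 : ContDiff ℝ 0 fun z : ℝ × 𝔼 => deriv (deriv (fun s => w s z.2)) z.1 :=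
    contDiff_deriv_time (k := 0) (w := fun t x => deriv (fun s => w s x) t) (by simpa using hw1)
  have hs : Continuous fun x : 𝔼 => (t, x) := by fun_prop
  have c1 : Continuous fun x : 𝔼 => deriv (fun s => w s x) t := hw1.continuous.comp hs
  have c2 : Continuous fun x : 𝔼 => deriv (deriv (fun s => w s x)) t := hw2.continuous.comp hs
  have hexp : Continuous fun x : 𝔼 => exp (inner ℝ ω x) := by fun_prop
  have hi : ∀ {g : 𝔼 → ℝ}, Continuous g → IntegrableOn g (Metric.closedBall 0 (R + T)) :=
    fun hg => hg.continuousOn.integrableOn_compact hK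
  have k1 : Continuous fun x : 𝔼 => b * (deriv (fun s => w s x) t * exp (inner ℝ ω x)) :=
    continuous_const.mul (c1.mul hexp)
  have k2 : Continuous fun x : 𝔼 => deriv (deriv (fun s => w s x)) t * exp (inner ℝ ω x) :=
    c2.mul hexp
  simp only [expMoment]
  rw [← hIBP, ← integral_const_mul, ← integral_add (hi k2) (hi k1), ← sub_eq_iff_eq_add',
    ← integral_sub]
  · refine integral_congr_ae (Filter.Eventually.of_forall fun x => ?_)
    simp only [← heq t ht x]
    ring
  · exact hi (k2.add k1)
  · have : laplacian (w t) = fun x => deriv (deriv (fun s => w s x)) t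
        + b * deriv (fun s => w s x) t - f t x := by
      ext x; rw [← heq t ht x]; ring
    simp only [this]
    exact hi (((c2.add (continuous_const.mul c1)).sub (hf.comp hs)).mul hexp)

end Moment

lemma test_function_ineq {b τ r : ℝ} (hb : 0 ≤ b) (hτ : 0 < τ) (hr : 1 < r) {k : ℕ}
    (hk : 2 * r ≤ k * (r - 1)) {G G₁ G₂ A : ℝ → ℝ} (hG : ∀ t, HasDerivAt G (G₁ t) t)
    (hG₁ : ∀ t, HasDerivAt G₁ (G₂ t) t) (hG₂ : Continuous G₂)
    (hA : ∀ t ∈ Icc 0 τ, G₂ t + b * G₁ t = A t) (hA0 : ∀ t, 0 ≤ A t)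
    (h0 : 0 ≤ G 0) (h1 : 0 ≤ G₁ 0) :
    ((∫ t in Icc 0 τ, A t * |1 - t / τ| ^ k) + G₁ 0) ^ r ≤
      (k ^ 2 / τ ^ 2 + b * k / τ) ^ r * τ ^ (r - 1) *
        ∫ t in Icc 0 τ, |G t| ^ r * |1 - t / τ| ^ k := by
  have hk2 : 2 ≤ k := by
    have : (2 : ℝ) < k := by
      by_contra! h
      nlinarith
    exact_mod_cast this.le
  obtain ⟨m, rfl⟩ := Nat.exists_eq_add_of_le' hk2
  have cG : Continuous G := continuous_iff_continuousAt.2 fun t => (hG t).continuousAt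
  have cG₁ : Continuous G₁ := continuous_iff_continuousAt.2 fun t => (hG₁ t).continuousAt
  have hr0 : 0 < r := by linarith
  have hη : ∀ (j : ℕ) (t : ℝ), HasDerivAt (fun t => (1 - t / τ) ^ (j + 1))
      ((j + 1) * (1 - t / τ) ^ j * (-1 / τ)) t := fun j t => by
    have : HasDerivAt (fun t => 1 - t / τ) (-1 / τ) t := by
      simpa [neg_div] using ((hasDerivAt_id t).div_const τ).const_sub 1
    exact (this.pow (j + 1)).congr_deriv (by simp)
  set η : ℝ → ℝ := fun t => (1 - t / τ) ^ (m + 2)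
  set η₁ : ℝ → ℝ := fun t => (m + 2) * (1 - t / τ) ^ (m + 1) * (-1 / τ)
  set η₂ : ℝ → ℝ := fun t => (m + 2) * (m + 1) / τ ^ 2 * (1 - t / τ) ^ m
  have dη : ∀ t, HasDerivAt η (η₁ t) t := fun t => by
    refine (hη (m + 1) t).congr_deriv ?_
    simp only [η₁]; push_cast; ring
  have dη₁ : ∀ t, HasDerivAt η₁ (η₂ t) t := fun t => by
    refine (((hη m t).const_mul ((m : ℝ) + 2)).mul_const (-1 / τ)).congr_deriv ?_
    simp only [η₂]; field_simp
  have hFTC : ∫ t in (0 : ℝ)..τ, ((G₂ t + b * G₁ t) * η t - G t * (η₂ t - b * η₁ t)) =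
      (G₁ τ * η τ - G τ * η₁ τ + b * (G τ * η τ)) -
        (G₁ 0 * η 0 - G 0 * η₁ 0 + b * (G 0 * η 0)) := by
    refine intervalIntegral.integral_eq_sub_of_hasDerivAt
      (f := fun t => G₁ t * η t - G t * η₁ t + b * (G t * η t)) (fun t _ => ?_) ?_
    · exact ((((hG₁ t).mul (dη t)).sub ((hG t).mul (dη₁ t))).add
        (((hG t).mul (dη t)).const_mul b)).congr_deriv (by ring)
    · exact Continuous.intervalIntegrable (by fun_prop) _ _
  have e1 : η τ = 0 := by simp [η, hτ.ne']
  have e2 : η₁ τ = 0 := by simp [η₁, hτ.ne']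
  have e3 : η 0 = 1 := by simp [η]
  have e4 : η₁ 0 = -(m + 2) / τ := by simp [η₁]; ring
  rw [intervalIntegral.integral_of_le hτ.le, ← integral_Icc_eq_integral_Ioc, integral_sub
    ((by fun_prop : Continuous _).continuousOn.integrableOn_compact isCompact_Icc)
    ((by fun_prop : Continuous _).continuousOn.integrableOn_compact isCompact_Icc),
    e1, e2, e3, e4] at hFTC
  have hs : ∀ t ∈ Icc 0 τ, 0 ≤ 1 - t / τ ∧ 1 - t / τ ≤ 1 := fun t ht =>
    ⟨sub_nonneg.2 ((div_le_one hτ).2 ht.2), by linarith [div_nonneg ht.1 hτ.le]⟩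
  have hAη : ∫ t in Icc 0 τ, (G₂ t + b * G₁ t) * η t =
      ∫ t in Icc 0 τ, A t * |1 - t / τ| ^ (m + 2) := by
    refine setIntegral_congr_fun measurableSet_Icc fun t ht => ?_
    simp only [η, hA t ht, abs_of_nonneg (hs t ht).1]
  set M : ℝ := ((m + 2 : ℕ) : ℝ) ^ 2 / τ ^ 2 + b * ((m + 2 : ℕ) : ℝ) / τ with hM
  have hM0 : 0 ≤ M := by positivity
  set f : ℝ → ℝ := fun t => G t * |1 - t / τ| ^ (((m + 2 : ℕ) : ℝ) / r) with hf
  have cf : Continuous f := cG.mul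
    ((by fun_prop : Continuous fun t => |1 - t / τ|).rpow_const fun t => Or.inr (by positivity))
  have hle : ∫ t in Icc 0 τ, G t * (η₂ t - b * η₁ t) ≤ M * ∫ t in Icc 0 τ, |f t| * 1 := by
    rw [← integral_const_mul]
    refine setIntegral_mono_on
      ((by fun_prop : Continuous _).continuousOn.integrableOn_compact isCompact_Icc)
      ((by fun_prop : Continuous _).continuousOn.integrableOn_compact isCompact_Icc)
      measurableSet_Icc fun t ht => ?_
    obtain ⟨hs0, hs1⟩ := hs t ht
    have hpow : (1 - t / τ) ^ m ≤ (1 - t / τ) ^ (((m + 2 : ℕ) : ℝ) / r) := by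
      rw [← Real.rpow_natCast]
      rcases hs0.eq_or_lt with h | h
      · rw [← h]
        by_cases hm : m = 0
        · subst hm
          exfalso
          push_cast at hk
          linarith
        · rw [Real.zero_rpow (by exact_mod_cast hm)]
          positivity
      · refine Real.rpow_le_rpow_of_exponent_ge h hs1 ?_
        rw [div_le_iff₀ hr0]
        push_cast at hk ⊢
        linarith
    have h2 : η₂ t - b * η₁ t ≤ M * (1 - t / τ) ^ m := by
      have h3 : (1 - t / τ) ^ (m + 1) ≤ (1 - t / τ) ^ m := pow_le_pow_of_le_one hs0 hs1 (by simp)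
      have h4 : η₂ t - b * η₁ t = (m + 2) * (m + 1) / τ ^ 2 * (1 - t / τ) ^ m +
          b * (m + 2) / τ * (1 - t / τ) ^ (m + 1) := by
        simp only [η₁, η₂]; ring
      have h5 : M * (1 - t / τ) ^ m = (m + 2) * (m + 2) / τ ^ 2 * (1 - t / τ) ^ m +
          b * (m + 2) / τ * (1 - t / τ) ^ m := by
        rw [hM]; push_cast; ring
      rw [h4, h5]
      gcongr
      norm_num
    have h5 : 0 ≤ η₂ t - b * η₁ t := by
      have h4 : η₂ t - b * η₁ t = (m + 2) * (m + 1) / τ ^ 2 * (1 - t / τ) ^ m +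
          b * (m + 2) / τ * (1 - t / τ) ^ (m + 1) := by
        simp only [η₁, η₂]; ring
      rw [h4]; positivity
    calc G t * (η₂ t - b * η₁ t) ≤ |G t| * (M * (1 - t / τ) ^ m) :=
          mul_le_mul (le_abs_self _) h2 h5 (abs_nonneg _)
      _ ≤ |G t| * (M * (1 - t / τ) ^ (((m + 2 : ℕ) : ℝ) / r)) := by gcongr
      _ = M * (|f t| * 1) := by
          simp only [f, abs_mul, abs_of_nonneg hs0,
            abs_of_nonneg (Real.rpow_nonneg hs0 _)]
          ring
  have hH := setIntegral_mul_rpow_le (μ := volume) (isCompact_Icc (a := (0 : ℝ)) (b := τ)) cf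
    (continuous_const (y := (1 : ℝ))) (fun _ => zero_le_one) (Real.HolderConjugate.conjExponent hr)
  have e5 : ∫ t in Icc 0 τ, (1 : ℝ) ^ (r.conjExponent) = τ := by
    simp [hτ.le]
  have e6 : ∫ t in Icc 0 τ, |f t| ^ r = ∫ t in Icc 0 τ, |G t| ^ r * |1 - t / τ| ^ (m + 2) := by
    congr 1
    ext t
    have : 0 ≤ |1 - t / τ| := abs_nonneg _
    simp only [f, abs_mul, abs_of_nonneg (Real.rpow_nonneg this _)]
    rw [Real.mul_rpow (abs_nonneg _) (Real.rpow_nonneg this _), ← Real.rpow_mul this,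
      div_mul_cancel₀ _ hr0.ne', Real.rpow_natCast]
  rw [e5, e6] at hH
  have hI : 0 ≤ ∫ t in Icc 0 τ, A t * |1 - t / τ| ^ (m + 2) :=
    integral_nonneg fun t => mul_nonneg (hA0 t) (by positivity)
  have hfin : (∫ t in Icc 0 τ, A t * |1 - t / τ| ^ (m + 2)) + G₁ 0 ≤
      M * ∫ t in Icc 0 τ, |f t| * 1 := by
    refine le_trans ?_ hle
    rw [← hAη]
    have : 0 ≤ G 0 * ((m + 2) / τ) := by positivity
    have : 0 ≤ b * G 0 := by positivity
    have : G 0 * (-(m + 2) / τ) = -(G 0 * ((m + 2) / τ)) := by ring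
    linarith
  calc _ ≤ (M * ∫ t in Icc 0 τ, |f t| * 1) ^ r :=
        Real.rpow_le_rpow (by positivity) hfin hr0.le
    _ = M ^ r * (∫ t in Icc 0 τ, |f t| * 1) ^ r :=
        Real.mul_rpow hM0 (integral_nonneg fun t => by positivity)
    _ ≤ M ^ r * ((∫ t in Icc 0 τ, |G t| ^ r * |1 - t / τ| ^ (m + 2)) * τ ^ (r - 1)) := by
        gcongr
    _ = _ := by ring

lemma sinh_lower_bound {τ : ℝ} {G G₁ G₂ : ℝ → ℝ} (hG : ∀ t, HasDerivAt G (G₁ t) t)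
    (hG₁ : ∀ t, HasDerivAt G₁ (G₂ t) t) (hle : ∀ t ∈ Icc 0 τ, G t ≤ G₂ t) (h0 : 0 ≤ G 0)
    (h1 : 0 ≤ G₁ 0) {t : ℝ} (ht1 : 1 ≤ t) (ht : t ≤ τ) : G₁ 0 / 4 * exp t ≤ G t := by
  have d1 : ∀ t, HasDerivAt (fun t => (G₁ t + G t) * exp (-t)) ((G₂ t - G t) * exp (-t)) t := by
    intro t
    refine (((hG₁ t).add (hG t)).mul ((hasDerivAt_neg t).exp)).congr_deriv ?_
    simp only [Pi.add_apply]
    ring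
  have m1 : MonotoneOn (fun t => (G₁ t + G t) * exp (-t)) (Icc 0 τ) := by
    refine monotoneOn_of_deriv_nonneg (convex_Icc 0 τ)
      (fun t _ => (d1 t).continuousAt.continuousWithinAt)
      (fun t _ => (d1 t).differentiableAt.differentiableWithinAt) fun t ht => ?_
    rw [(d1 t).deriv]
    rw [interior_Icc] at ht
    exact mul_nonneg (sub_nonneg.2 (hle t (Ioo_subset_Icc_self ht))) (exp_pos _).le
  have hH : ∀ t ∈ Icc 0 τ, G₁ 0 * exp t ≤ G₁ t + G t := by
    intro t ht
    have h := m1 ⟨le_rfl, ht.1.trans ht.2⟩ ht ht.1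
    simp only [neg_zero, exp_zero, mul_one] at h
    calc G₁ 0 * exp t ≤ (G₁ t + G t) * exp (-t) * exp t := by
          gcongr; linarith
      _ = _ := by rw [mul_assoc, ← exp_add]; simp
  have d2 : ∀ t, HasDerivAt (fun t => G t * exp t - G₁ 0 / 2 * exp (2 * t))
      ((G₁ t + G t - G₁ 0 * exp t) * exp t) t := by
    intro t
    refine (((hG t).mul (hasDerivAt_exp t)).sub
      ((((hasDerivAt_id t).const_mul 2).exp).const_mul (G₁ 0 / 2))).congr_deriv ?_
    have : exp (2 * t) = exp t * exp t := by rw [← exp_add]; ring_nf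
    simp only [id, this]
    ring
  have m2 : MonotoneOn (fun t => G t * exp t - G₁ 0 / 2 * exp (2 * t)) (Icc 0 τ) := by
    refine monotoneOn_of_deriv_nonneg (convex_Icc 0 τ)
      (fun t _ => (d2 t).continuousAt.continuousWithinAt)
      (fun t _ => (d2 t).differentiableAt.differentiableWithinAt) fun t ht => ?_
    rw [(d2 t).deriv]
    rw [interior_Icc] at ht
    exact mul_nonneg (sub_nonneg.2 (hH t (Ioo_subset_Icc_self ht))) (exp_pos _).le
  have h := m2 ⟨le_rfl, by linarith⟩ ⟨by linarith, ht⟩ (by linarith : (0 : ℝ) ≤ t)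
  simp only [exp_zero, mul_one, mul_zero] at h
  have e2 : exp (2 * t) = exp t * exp t := by rw [← exp_add]; ring_nf
  have e3 : 2 ≤ exp t := by linarith [add_one_le_exp t]
  have e4 : 4 ≤ exp t * exp t := by nlinarith
  rw [e2] at h
  refine le_of_mul_le_mul_right ?_ (exp_pos t)
  nlinarith [mul_nonneg h1 (by linarith : 0 ≤ exp t * exp t - 4)]

section Directions

variable {m : ℕ}

local notation "𝔼" => EuclideanSpace ℝ (Fin (m + 1))

/-- The unit vector in the upper hemisphere lying above the point `y` of the unit ball. -/
noncomputable def hemisphereLift (y : Fin m → ℝ) : 𝔼 :=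
  WithLp.toLp 2 (Fin.cons (√(1 - ∑ i, y i ^ 2)) y)

lemma norm_hemisphereLift {y : Fin m → ℝ} (hy : ∑ i, y i ^ 2 ≤ 1) : ‖hemisphereLift y‖ = 1 := by
  rw [← sq_eq_sq₀ (norm_nonneg _) zero_le_one, EuclideanSpace.norm_sq_eq, Fin.sum_univ_succ]
  simp [hemisphereLift, Real.sq_sqrt (sub_nonneg.2 hy)]

lemma inner_le_of_norm_eq_one {ω x : 𝔼} (hω : ‖ω‖ = 1) (hx : 0 < ‖x‖) :
    inner ℝ ω x ≤ ‖x‖ - ‖x‖ / 2 * ∑ i : Fin m, (ω i.succ - x i.succ / ‖x‖) ^ 2 := by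
  have h1 : ∑ i : Fin m, (ω i.succ - x i.succ / ‖x‖) ^ 2 ≤ ‖ω - ‖x‖⁻¹ • x‖ ^ 2 := by
    rw [EuclideanSpace.norm_sq_eq, Fin.sum_univ_succ]
    simp only [PiLp.sub_apply, PiLp.smul_apply, smul_eq_mul, Real.norm_eq_abs, sq_abs]
    have : ∀ i : Fin m, x i.succ / ‖x‖ = ‖x‖⁻¹ * x i.succ := fun i => by
      rw [div_eq_mul_inv, mul_comm]
    simp only [this]
    linarith [sq_nonneg (ω 0 - ‖x‖⁻¹ * x 0)]
  have h2 : ‖ω - ‖x‖⁻¹ • x‖ ^ 2 = 2 - 2 * (‖x‖⁻¹ * inner ℝ ω x) := by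
    rw [norm_sub_sq_real, inner_smul_right, norm_smul, norm_inv, norm_norm,
      inv_mul_cancel₀ hx.ne', hω]
    ring
  rw [h2] at h1
  have h3 := mul_le_mul_of_nonneg_left h1 (half_pos hx).le
  have h4 : ‖x‖ / 2 * (2 - 2 * (‖x‖⁻¹ * inner ℝ ω x)) = ‖x‖ - inner ℝ ω x := by
    field_simp
  linarith

/-- There are many unit vectors whose plane waves have a uniformly small average. -/
lemma exists_directions (m : ℕ) : ∃ S : ℝ, 0 < S ∧ ∀ τ : ℝ, 1 ≤ τ →
    ∃ (s : Finset (Fin m → ℕ)) (ω : (Fin m → ℕ) → EuclideanSpace ℝ (Fin (m + 1))),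
      s.Nonempty ∧ (∀ k ∈ s, ‖ω k‖ = 1) ∧ ∀ x, τ / 8 ≤ ‖x‖ →
        ∑ k ∈ s, exp (inner ℝ (ω k) x) ≤ s.card * (S * τ ^ (-(m : ℝ) / 2) * exp ‖x‖) := by
  have ha : (0 : ℝ) < 1 / (64 * (m + 1) ^ 2) := by positivity
  obtain ⟨S, hS, hsum⟩ := exists_sum_exp_neg_sq_le ha
  refine ⟨S ^ m, by positivity, fun τ hτ => ?_⟩
  have hτ0 : 0 < τ := by linarith
  set N : ℕ := ⌈√τ⌉₊ with hN
  have hN1 : √τ ≤ N := Nat.le_ceil _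
  have hsq : 1 ≤ √τ := Real.one_le_sqrt.2 hτ
  have hN2 : (N : ℝ) ≤ 2 * √τ := by linarith [Nat.ceil_lt_add_one (Real.sqrt_nonneg τ)]
  have hN0 : (0 : ℝ) < N := by linarith
  have hNτ : (N : ℝ) ^ 2 ≤ 4 * τ := by nlinarith [Real.sq_sqrt hτ0.le]
  have hNpos : 0 < N := by exact_mod_cast hN0
  let y : (Fin m → ℕ) → Fin m → ℝ := fun k i => k i / (N * (m + 1))
  have hy : ∀ k ∈ Fintype.piFinset (fun _ : Fin m => Finset.range N), ∑ i, y k i ^ 2 ≤ 1 := by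
    intro k hk
    have : ∀ i, y k i ^ 2 ≤ 1 / (m + 1) := fun i => by
      have hki : (k i : ℝ) ≤ N := by
        exact_mod_cast (Finset.mem_range.1 (Fintype.mem_piFinset.1 hk i)).le
      have h1 : y k i ≤ 1 / (m + 1) := by
        simp only [y]
        rw [div_le_div_iff₀ (by positivity) (by positivity)]
        nlinarith
      have h0 : 0 ≤ y k i := by positivity
      have h2 : (1 : ℝ) / (m + 1) ≤ 1 := by
        rw [div_le_one (by positivity)]; linarith [(Nat.cast_nonneg m : (0 : ℝ) ≤ m)]
      nlinarith
    refine (Finset.sum_le_sum fun i _ => this i).trans ?_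
    simp only [Finset.sum_const, Finset.card_univ, Fintype.card_fin, nsmul_eq_mul]
    rw [mul_one_div, div_le_one (by positivity)]
    linarith
  refine ⟨Fintype.piFinset fun _ => Finset.range N, fun k => hemisphereLift (y k),
    ⟨fun _ => 0, by simp [hNpos]⟩, fun k hk => norm_hemisphereLift (hy k hk), fun x hx => ?_⟩
  have hx0 : 0 < ‖x‖ := by linarith
  have hcard : ((Fintype.piFinset fun _ : Fin m => Finset.range N).card : ℝ) = (N : ℝ) ^ m := by
    simp
  calc _ ≤ ∑ k ∈ Fintype.piFinset fun _ : Fin m => Finset.range N, exp ‖x‖ *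
          ∏ i, exp (-(1 / (64 * (m + 1) ^ 2)) *
            ((k i : ℝ) - N * (m + 1) * (x i.succ / ‖x‖)) ^ 2) := by
        refine Finset.sum_le_sum fun k hk => ?_
        rw [← exp_sum, ← exp_add]
        refine exp_le_exp.2 ((inner_le_of_norm_eq_one (norm_hemisphereLift (hy k hk)) hx0).trans ?_)
        rw [sub_eq_add_neg]
        gcongr
        rw [Finset.mul_sum, ← Finset.sum_neg_distrib]
        refine Finset.sum_le_sum fun i _ => ?_
        have e1 : (hemisphereLift (y k)) i.succ = k i / (N * (m + 1)) := by
          simp [hemisphereLift, y]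
        rw [e1, neg_mul, neg_le_neg_iff]
        have e2 : (k i : ℝ) / (N * (m + 1)) - x i.succ / ‖x‖ =
          ((k i : ℝ) - N * (m + 1) * (x i.succ / ‖x‖)) / (N * (m + 1)) := by
          field_simp
        rw [e2]
        generalize (k i : ℝ) - N * (m + 1) * (x i.succ / ‖x‖) = z
        have e3 : ‖x‖ / 2 * (z / (N * (m + 1))) ^ 2 = ‖x‖ / 2 / (N * (m + 1)) ^ 2 * z ^ 2 := by
          rw [div_pow]; ring
        rw [e3]
        refine mul_le_mul_of_nonneg_right ?_ (sq_nonneg z)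
        rw [mul_pow, div_le_div_iff₀ (by positivity) (by positivity), one_mul]
        have : (N : ℝ) ^ 2 * (m + 1) ^ 2 ≤ ‖x‖ / 2 * (64 * (m + 1) ^ 2) := by
          have : (N : ℝ) ^ 2 ≤ 32 * ‖x‖ := by linarith
          nlinarith [sq_nonneg ((m : ℝ) + 1)]
        exact this
    _ = exp ‖x‖ * ∏ i : Fin m, ∑ j ∈ Finset.range N, exp (-(1 / (64 * (m + 1) ^ 2)) *
            ((j : ℝ) - N * (m + 1) * (x i.succ / ‖x‖)) ^ 2) := by
        rw [Finset.prod_univ_sum, Finset.mul_sum]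
    _ ≤ exp ‖x‖ * S ^ m := by
        gcongr
        refine (Finset.prod_le_prod (fun i _ => by positivity) fun i _ => hsum _ _).trans ?_
        simp
    _ ≤ _ := by
        rw [hcard]
        have h1 : 1 ≤ (N : ℝ) ^ m * τ ^ (-(m : ℝ) / 2) := by
          have h2 : τ ^ (-(m : ℝ) / 2) = ((√τ) ^ m)⁻¹ := by
            rw [Real.sqrt_eq_rpow, ← Real.rpow_natCast, ← Real.rpow_mul hτ0.le,
              ← Real.rpow_neg hτ0.le]
            congr 1; ring
          rw [h2, ← div_eq_mul_inv, one_le_div (by positivity)]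
          gcongr
        calc exp ‖x‖ * S ^ m = exp ‖x‖ * S ^ m * 1 := by ring
          _ ≤ exp ‖x‖ * S ^ m * ((N : ℝ) ^ m * τ ^ (-(m : ℝ) / 2)) := by gcongr
          _ = _ := by ring

lemma exists_integral_exp_norm_le (m : ℕ) {a : ℝ} (ha : 0 < a) : ∃ C : ℝ, 0 < C ∧ ∀ ρ : ℝ, 0 ≤ ρ →
    ∫ x in Metric.closedBall (0 : EuclideanSpace ℝ (Fin (m + 1))) ρ, exp (a * ‖x‖) ≤
      C * ρ ^ m * exp (a * ρ) := by
  set V : ℝ := (volume : Measure (EuclideanSpace ℝ (Fin (m + 1)))).real (Metric.ball 0 1) with hV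
  have hV0 : 0 < V := ENNReal.toReal_pos (Metric.measure_ball_pos _ _ one_pos).ne'
    measure_ball_lt_top.ne
  refine ⟨(m + 1) * V / a, by positivity, fun ρ hρ => ?_⟩
  have h := integral_fun_norm_addHaar (volume : Measure (EuclideanSpace ℝ (Fin (m + 1))))
    (indicator (Iic ρ) fun y => exp (a * y))
  have h1 : ∫ x in Metric.closedBall (0 : EuclideanSpace ℝ (Fin (m + 1))) ρ, exp (a * ‖x‖) =
      ∫ x : EuclideanSpace ℝ (Fin (m + 1)), (Iic ρ).indicator (fun y => exp (a * y)) ‖x‖ := by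
    rw [← integral_indicator Metric.isClosed_closedBall.measurableSet]
    congr 1; ext x
    simp [indicator]
  have h2 : ∫ y in Ioi (0 : ℝ), y ^ (Module.finrank ℝ (EuclideanSpace ℝ (Fin (m + 1))) - 1) •
      (Iic ρ).indicator (fun y => exp (a * y)) y = ∫ y in (0 : ℝ)..ρ, y ^ m * exp (a * y) := by
    rw [intervalIntegral.integral_of_le hρ, ← Ioi_inter_Iic,
      ← setIntegral_indicator measurableSet_Iic]
    congr 1; ext y
    by_cases hy : y ≤ ρ <;> simp [indicator, hy]
  have h3 : ∫ y in (0 : ℝ)..ρ, y ^ m * exp (a * y) ≤ ρ ^ m * exp (a * ρ) / a := by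
    calc _ ≤ ∫ y in (0 : ℝ)..ρ, ρ ^ m * exp (a * y) := by
          refine intervalIntegral.integral_mono_on hρ (Continuous.intervalIntegrable (by fun_prop) _ _)
            (Continuous.intervalIntegrable (by fun_prop) _ _) fun y hy => ?_
          have := hy.1; have := hy.2
          gcongr
      _ = ρ ^ m * ((exp (a * ρ) - 1) / a) := by
          rw [intervalIntegral.integral_const_mul]
          congr 1
          have hd : ∀ y : ℝ, HasDerivAt (fun y => exp (a * y) / a) (exp (a * y)) y := fun y =>
            ((((hasDerivAt_id y).const_mul a).exp).div_const a).congr_deriv (by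
              simp only [id]; field_simp)
          rw [intervalIntegral.integral_eq_sub_of_hasDerivAt (fun y _ => hd y)
            (Continuous.intervalIntegrable (by fun_prop) _ _)]
          simp [sub_div]
      _ ≤ _ := by
          rw [mul_div_assoc]
          gcongr
          linarith
  rw [h1, h, h2]
  simp only [finrank_euclideanSpace, Fintype.card_fin, nsmul_eq_mul, smul_eq_mul, ← hV]
  push_cast
  calc _ ≤ ((m : ℝ) + 1) * (V * (ρ ^ m * exp (a * ρ) / a)) := by gcongr
    _ = _ := by ring

end Directions

lemma exists_average_plane_waves_le (m : ℕ) (R : ℝ) :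
    ∃ C : ℝ, 0 < C ∧ ∀ τ : ℝ, 1 ≤ τ →
      ∃ (s : Finset (Fin m → ℕ)) (ω : (Fin m → ℕ) → EuclideanSpace ℝ (Fin (m + 1))),
        s.Nonempty ∧ (∀ k ∈ s, ‖ω k‖ = 1) ∧ ∀ t ∈ Icc (τ / 4) (τ / 2), ∀ x, ‖x‖ ≤ R + t →
          (∑ k ∈ s, exp (inner ℝ (ω k) x)) / s.card ≤
            C * τ ^ (-(m : ℝ) / 2) * exp ((‖x‖ + t) / 2) := by
  obtain ⟨S, hS, hdir⟩ := exists_directions m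
  refine ⟨S * exp (R / 2) + 16 ^ m * m.factorial, by positivity, fun τ hτ => ?_⟩
  obtain ⟨s, ω, hs, hω, hsum⟩ := hdir τ hτ
  refine ⟨s, ω, hs, hω, fun t ht x hx => ?_⟩
  have hcard : (0 : ℝ) < s.card := by exact_mod_cast hs.card_pos
  have hτ0 : 0 < τ := by linarith
  have hP : 0 < τ ^ (-(m : ℝ) / 2) := Real.rpow_pos_of_pos hτ0 _
  rw [div_le_iff₀' hcard, add_mul, add_mul]
  obtain ⟨ht1, ht2⟩ := ht
  by_cases hx8 : τ / 8 ≤ ‖x‖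
  · refine (hsum x hx8).trans (mul_le_mul_of_nonneg_left ?_ hcard.le)
    have h1 : exp ‖x‖ ≤ exp (R / 2) * exp ((‖x‖ + t) / 2) := by
      rw [← exp_add]; exact exp_le_exp.2 (by linarith)
    have h2 : 0 ≤ 16 ^ m * (m.factorial : ℝ) * τ ^ (-(m : ℝ) / 2) * exp ((‖x‖ + t) / 2) := by
      positivity
    calc S * τ ^ (-(m : ℝ) / 2) * exp ‖x‖
        ≤ S * τ ^ (-(m : ℝ) / 2) * (exp (R / 2) * exp ((‖x‖ + t) / 2)) := by gcongr
      _ = S * exp (R / 2) * τ ^ (-(m : ℝ) / 2) * exp ((‖x‖ + t) / 2) := by ring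
      _ ≤ _ := by linarith
  · push Not at hx8
    have h1 : ∑ k ∈ s, exp (inner ℝ (ω k) x) ≤ s.card * exp ‖x‖ := by
      rw [← nsmul_eq_mul]
      refine Finset.sum_le_card_nsmul _ _ _ fun k hk => exp_le_exp.2 ?_
      simpa [hω k hk] using real_inner_le_norm (ω k) x
    refine h1.trans (mul_le_mul_of_nonneg_left ?_ hcard.le)
    have h2 : exp ‖x‖ ≤ exp (-(τ / 16)) * exp ((‖x‖ + t) / 2) := by
      rw [← exp_add]; exact exp_le_exp.2 (by linarith)
    have h3 : exp (-(τ / 16)) ≤ 16 ^ m * m.factorial * τ ^ (-(m : ℝ) / 2) := by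
      have h4 := Real.pow_div_factorial_le_exp (τ / 16) (by positivity) m
      have h5 : τ ^ ((m : ℝ) / 2) ≤ τ ^ m := by
        rw [← Real.rpow_natCast]
        exact Real.rpow_le_rpow_of_exponent_le hτ (by linarith [(Nat.cast_nonneg m : (0:ℝ) ≤ m)])
      rw [neg_div, Real.rpow_neg hτ0.le, exp_neg, ← div_eq_mul_inv, inv_eq_one_div,
        div_le_div_iff₀ (exp_pos _) (by positivity), one_mul]
      have h6 : τ ^ m = 16 ^ m * m.factorial * ((τ / 16) ^ m / m.factorial) := by
        rw [div_pow]
        field_simp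
      calc _ ≤ τ ^ m := h5
        _ = _ := h6
        _ ≤ _ := by gcongr
    have h4 : 0 ≤ S * exp (R / 2) * τ ^ (-(m : ℝ) / 2) * exp ((‖x‖ + t) / 2) := by
      positivity
    calc exp ‖x‖ ≤ exp (-(τ / 16)) * exp ((‖x‖ + t) / 2) := h2
      _ ≤ 16 ^ m * m.factorial * τ ^ (-(m : ℝ) / 2) * exp ((‖x‖ + t) / 2) := by gcongr
      _ ≤ _ := by linarith

/-- A function whose exponential moments in all directions are large has a large `L^p` norm. -/
lemma exists_integral_rpow_ge (m : ℕ) {R p : ℝ} (hR : 0 < R) (hp : 1 < p) :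
    ∃ c : ℝ, 0 < c ∧ ∀ τ : ℝ, 4 ≤ τ → ∀ t ∈ Icc (τ / 4) (τ / 2), ∀ M : ℝ, 0 ≤ M →
      ∀ v : EuclideanSpace ℝ (Fin (m + 1)) → ℝ, Continuous v →
        (∀ ω, ‖ω‖ = 1 → M * exp t ≤ ∫ x in Metric.closedBall 0 (R + t), v x * exp (inner ℝ ω x)) →
        c * M ^ p * τ ^ ((m : ℝ) - m * p / 2) ≤
          ∫ x in Metric.closedBall 0 (R + t), |v x| ^ p := by
  have hconj := Real.HolderConjugate.conjExponent hp
  set p' := p.conjExponent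
  have hp' : 0 < p' := hconj.symm.pos
  have hp0 : 0 < p := by linarith
  obtain ⟨C₁, hC₁, havg⟩ := exists_average_plane_waves_le m R
  obtain ⟨C₂, hC₂, hrad⟩ := exists_integral_exp_norm_le m (by positivity : 0 < p' / 2)
  set D : ℝ := C₁ ^ p' * (C₂ * (R + 1) ^ m) * exp (p' / 2 * R) with hD
  have hD0 : 0 < D := by positivity
  refine ⟨(D ^ (p - 1))⁻¹, by positivity, fun τ hτ t ht M hM v hv hmom => ?_⟩
  have hτ0 : 0 < τ := by linarith
  obtain ⟨s, ω, hs, hω, hΦ⟩ := havg τ (by linarith)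
  specialize hΦ t ht
  have hcard : (0 : ℝ) < s.card := by exact_mod_cast hs.card_pos
  set K := Metric.closedBall (0 : EuclideanSpace ℝ (Fin (m + 1))) (R + t) with hKdef
  have hK : IsCompact K := isCompact_closedBall _ _
  obtain ⟨ht1, ht2⟩ := ht
  have ht0 : 0 ≤ t := by linarith
  set Φ : EuclideanSpace ℝ (Fin (m + 1)) → ℝ :=
    fun x => (∑ k ∈ s, exp (inner ℝ (ω k) x)) / s.card with hΦdef
  have cΦ : Continuous Φ := by fun_prop
  have hΦ0 : ∀ x, 0 ≤ Φ x := fun x => by positivity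
  have hi : ∀ {g : EuclideanSpace ℝ (Fin (m + 1)) → ℝ}, Continuous g → IntegrableOn g K :=
    fun hg => hg.continuousOn.integrableOn_compact hK
  have hlow : M * exp t ≤ ∫ x in K, |v x| * Φ x := by
    have h1 : ∫ x in K, v x * Φ x = (∑ k ∈ s, ∫ x in K, v x * exp (inner ℝ (ω k) x)) / s.card := by
      rw [← integral_finsetSum _ fun k _ => hi (by fun_prop), ← integral_div]
      refine integral_congr_ae (ae_of_all _ fun x => ?_)
      simp only [Φ, ← Finset.mul_sum, mul_div_assoc]
    have h2 : M * exp t ≤ ∫ x in K, v x * Φ x := by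
      rw [h1, le_div_iff₀' hcard, ← nsmul_eq_mul]
      exact Finset.card_nsmul_le_sum _ _ _ fun k hk => hmom _ (hω k hk)
    refine h2.trans (integral_mono (hi (hv.mul cΦ)) (hi (hv.abs.mul cΦ)) fun x => ?_)
    exact mul_le_mul_of_nonneg_right (le_abs_self _) (hΦ0 x)
  have hH := setIntegral_mul_rpow_le (μ := volume) hK hv cΦ hΦ0 hconj
  have hL := (Real.rpow_le_rpow (by positivity) hlow hp0.le).trans hH
  have hpp : p' * (p - 1) = p := by
    have := hconj.sub_one_mul_conj
    linarith
  set P : ℝ := τ ^ (-(m : ℝ) / 2) with hP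
  have hP0 : 0 < P := Real.rpow_pos_of_pos hτ0 _
  have hQ : ∫ x in K, Φ x ^ p' ≤ D * (P ^ p' * τ ^ m * exp (p' * t)) := by
    calc _ ≤ ∫ x in K, (C₁ * P * exp (t / 2)) ^ p' * exp (p' / 2 * ‖x‖) := by
          refine setIntegral_mono_on (hi (cΦ.rpow_const fun _ => Or.inr hp'.le))
            (hi (by fun_prop)) hK.measurableSet fun x hx => ?_
          have hx' : ‖x‖ ≤ R + t := by simpa [K] using hx
          refine (Real.rpow_le_rpow (hΦ0 x) (hΦ x hx') hp'.le).trans (le_of_eq ?_)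
          have e1 : exp ((‖x‖ + t) / 2) = exp (t / 2) * exp (‖x‖ / 2) := by
            rw [← exp_add]; ring_nf
          rw [e1, ← mul_assoc, Real.mul_rpow (by positivity) (by positivity), ← Real.exp_mul]
          ring_nf
      _ ≤ (C₁ * P * exp (t / 2)) ^ p' * (C₂ * (R + t) ^ m * exp (p' / 2 * (R + t))) := by
          rw [integral_const_mul]
          gcongr
          exact hrad _ (by positivity)
      _ ≤ (C₁ * P * exp (t / 2)) ^ p' * (C₂ * ((R + 1) * τ) ^ m * exp (p' / 2 * (R + t))) := by
          gcongr
          nlinarith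
      _ = _ := by
          rw [Real.mul_rpow (by positivity) (by positivity),
            Real.mul_rpow (by positivity) (by positivity), ← Real.exp_mul, hD]
          have e1 : exp (p' / 2 * (R + t)) = exp (p' / 2 * R) * exp (t / 2 * p') := by
            rw [← exp_add]; ring_nf
          have e2 : exp (p' * t) = exp (t / 2 * p') * exp (t / 2 * p') := by
            rw [← exp_add]; ring_nf
          rw [e1, e2, mul_pow]
          ring
  have hA0 : 0 ≤ ∫ x in K, |v x| ^ p := integral_nonneg fun x => by positivity
  have hL2 : (M * exp t) ^ p ≤ (∫ x in K, |v x| ^ p) *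
      (D ^ (p - 1) * (P ^ p * (τ ^ m) ^ (p - 1) * exp t ^ p)) := by
    refine hL.trans (mul_le_mul_of_nonneg_left ?_ hA0)
    refine (Real.rpow_le_rpow (integral_nonneg fun x => Real.rpow_nonneg (hΦ0 x) _) hQ
      (by linarith)).trans (le_of_eq ?_)
    have e1 : (P ^ p') ^ (p - 1) = P ^ p := by rw [← Real.rpow_mul hP0.le, hpp]
    have e2 : exp (p' * t) ^ (p - 1) = exp t ^ p := by
      rw [← Real.exp_mul, ← Real.exp_mul, mul_right_comm, hpp, mul_comm]
    rw [Real.mul_rpow hD0.le (by positivity),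
      Real.mul_rpow (x := P ^ p' * τ ^ m) (by positivity) (by positivity),
      Real.mul_rpow (x := P ^ p') (by positivity) (by positivity), e1, e2]
  rw [Real.mul_rpow hM (by positivity), ← mul_assoc, ← mul_assoc] at hL2
  have hL3 : M ^ p ≤ _ := le_of_mul_le_mul_right hL2 (by positivity)
  have e3 : P ^ p * (τ ^ m) ^ (p - 1) * τ ^ ((m : ℝ) - m * p / 2) = 1 := by
    rw [hP, ← Real.rpow_natCast τ m, ← Real.rpow_mul hτ0.le, ← Real.rpow_mul hτ0.le,
      ← Real.rpow_add hτ0, ← Real.rpow_add hτ0]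
    have e5 : -(m : ℝ) / 2 * p + m * (p - 1) + (m - m * p / 2) = 0 := by ring
    rw [e5, Real.rpow_zero]
  have e4 : (D ^ (p - 1))⁻¹ * D ^ (p - 1) = 1 := inv_mul_cancel₀ (by positivity)
  calc (D ^ (p - 1))⁻¹ * M ^ p * τ ^ ((m : ℝ) - m * p / 2)
      ≤ (D ^ (p - 1))⁻¹ * ((∫ x in K, |v x| ^ p) * D ^ (p - 1) * (P ^ p * (τ ^ m) ^ (p - 1))) *
          τ ^ ((m : ℝ) - m * p / 2) := by gcongr
    _ = ((D ^ (p - 1))⁻¹ * D ^ (p - 1)) * (∫ x in K, |v x| ^ p) *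
          (P ^ p * (τ ^ m) ^ (p - 1) * τ ^ ((m : ℝ) - m * p / 2)) := by ring
    _ = _ := by rw [e3, e4]; ring

lemma volume_real_closedBall_le {m : ℕ} {R τ : ℝ} (hR : 0 < R) (hτ : 1 ≤ τ) :
    volume.real (Metric.closedBall (0 : EuclideanSpace ℝ (Fin (m + 1))) (R + 2 * τ)) ≤
      (R + 2) ^ (m + 1) * volume.real (Metric.closedBall (0 : EuclideanSpace ℝ (Fin (m + 1))) 1) *
        τ ^ (m + 1) := by
  rw [Measure.addHaar_real_closedBall' _ _ (by positivity), finrank_euclideanSpace_fin]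
  calc (R + 2 * τ) ^ (m + 1) * volume.real (Metric.closedBall (0 : EuclideanSpace ℝ (Fin (m + 1))) 1)
      ≤ ((R + 2) * τ) ^ (m + 1) *
          volume.real (Metric.closedBall (0 : EuclideanSpace ℝ (Fin (m + 1))) 1) := by
        gcongr
        nlinarith
    _ = _ := by rw [mul_pow]; ring

/-- The test function estimate for a solution of `w_tt - Δw + b w_t = f` with nonnegative data and
source: the time-weighted mass of `f` is controlled by that of `|w|^r`. -/
lemma exists_source_mass_le (m : ℕ) {R r b a D : ℝ} (hR : 0 < R) (hr : 1 < r) (hb : 0 ≤ b)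
    (hD : 0 < D) {k : ℕ} (hk : 2 * r ≤ k * (r - 1)) :
    ∃ C : ℝ, 0 < C ∧ ∀ τ : ℝ, 1 ≤ τ → k ^ 2 / τ ^ 2 + b * k / τ ≤ D * τ ^ (-a) →
      ∀ w f : ℝ → EuclideanSpace ℝ (Fin (m + 1)) → ℝ,
        ContDiff ℝ 2 (fun z : ℝ × EuclideanSpace ℝ (Fin (m + 1)) => w z.1 z.2) →
        Continuous (fun z : ℝ × EuclideanSpace ℝ (Fin (m + 1)) => f z.1 z.2) →
        (∀ t ∈ Set.Ico (0:ℝ) (2 * τ), ∀ x, deriv (deriv (fun s => w s x)) t - laplacian (w t) x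
          + b * deriv (fun s => w s x) t = f t x) →
        (∀ t ∈ Set.Ico (0:ℝ) (2 * τ), ∀ x, R + t < ‖x‖ → w t x = 0) →
        (∀ t x, 0 ≤ f t x) → (∀ x, 0 ≤ w 0 x) → (∀ x, 0 ≤ deriv (fun s => w s x) 0) →
        ((∫ t in Icc 0 τ, (∫ x in Metric.closedBall 0 (R + 2 * τ), f t x) * |1 - t / τ| ^ k)
          + ∫ x in Metric.closedBall 0 (R + 2 * τ), deriv (fun s => w s x) 0) ^ r ≤
        C * τ ^ (-a * r + (m + 2) * (r - 1)) *
          ∫ t in Icc 0 τ, (∫ x in Metric.closedBall 0 (R + 2 * τ), |w t x| ^ r) *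
            |1 - t / τ| ^ k := by
  set V := (R + 2) ^ (m + 1) *
    volume.real (Metric.closedBall (0 : EuclideanSpace ℝ (Fin (m + 1))) 1) with hV
  have hV0 : 0 < V := mul_pos (by positivity)
    (ENNReal.toReal_pos (Metric.measure_closedBall_pos _ _ one_pos).ne'
      measure_closedBall_lt_top.ne)
  refine ⟨D ^ r * V ^ (r - 1), by positivity,
    fun τ hτ hkD w f hw hf heq hsupp hf0 hw0 hw1 => ?_⟩
  have hτ0 : 0 < τ := by linarith
  have hr0 : 0 < r := by linarith
  set K := Metric.closedBall (0 : EuclideanSpace ℝ (Fin (m + 1))) (R + 2 * τ) with hKdef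
  have hK : IsCompact K := isCompact_closedBall _ _
  have hw' : ContDiff ℝ ((1 : ℕ) + 1) (fun z : ℝ × EuclideanSpace ℝ (Fin (m + 1)) => w z.1 z.2) :=
    hw.of_le (by norm_num)
  have hw1' := contDiff_deriv_time hw'
  have hwt : ∀ t, Continuous (w t) := fun t =>
    hw.continuous.comp (by fun_prop : Continuous fun x : EuclideanSpace ℝ (Fin (m + 1)) => (t, x))
  have hw1'' : ContDiff ℝ ((0 : ℕ) + 1) (fun z : ℝ × EuclideanSpace ℝ (Fin (m + 1)) =>
      deriv (fun s => w s z.2) z.1) := hw1'.of_le (by norm_num)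
  have hexp : ∀ g : ℝ → EuclideanSpace ℝ (Fin (m + 1)) → ℝ, ∀ t,
      expMoment K 0 g t = ∫ x in K, g t x := fun g t => by simp [expMoment]
  have key := test_function_ineq hb hτ0 hr hk (G := expMoment K 0 w) (A := expMoment K 0 f)
    (hasDerivAt_expMoment hK 0 hw') (hasDerivAt_expMoment hK 0 hw1'')
    (continuous_expMoment hK 0 (contDiff_deriv_time
      (w := fun t x => deriv (fun s => w s x) t) hw1'').continuous)
    (fun t ht => by
      have h := expMoment_deriv_deriv hw hf heq hsupp 0
        (⟨ht.1, by linarith [ht.2]⟩ : t ∈ Set.Ico (0:ℝ) (2 * τ))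
      simpa using h)
    (fun t => by rw [hexp]; exact integral_nonneg fun x => hf0 t x)
    (by rw [hexp]; exact integral_nonneg hw0) (by rw [hexp]; exact integral_nonneg hw1)
  simp only [hexp] at key
  refine key.trans ?_
  have cη : Continuous fun t : ℝ => |1 - t / τ| ^ k := by fun_prop
  have cW : Continuous fun t => ∫ x in K, |w t x| ^ r :=
    continuous_parametric_integral_of_continuous (f := fun t x => |w t x| ^ r)
      (hw.continuous.abs.rpow_const fun _ => Or.inr hr0.le) hK
  have cU : Continuous fun t => ∫ x in K, w t x :=
    continuous_parametric_integral_of_continuous hw.continuous hK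
  have hvol : volume.real K ≤ V * τ ^ (m + 1) := volume_real_closedBall_le hR hτ
  have hpt : ∀ t, |∫ x in K, w t x| ^ r ≤
      (∫ x in K, |w t x| ^ r) * (V * τ ^ (m + 1)) ^ (r - 1) := by
    intro t
    have h1 := setIntegral_mul_rpow_le (μ := volume) hK (hwt t) continuous_const
      (fun _ => zero_le_one) (Real.HolderConjugate.conjExponent hr)
    simp only [mul_one, Real.one_rpow, setIntegral_const, smul_eq_mul] at h1
    have h2 : |∫ x in K, w t x| ≤ ∫ x in K, |w t x| := abs_integral_le_integral_abs
    have h3 : 0 ≤ ∫ x in K, |w t x| ^ r := integral_nonneg fun x => by positivity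
    calc _ ≤ (∫ x in K, |w t x|) ^ r := by gcongr
      _ ≤ _ := h1
      _ ≤ _ := by gcongr
  have hint : ∫ t in Icc 0 τ, |∫ x in K, w t x| ^ r * |1 - t / τ| ^ k ≤
      (V * τ ^ (m + 1)) ^ (r - 1) *
        ∫ t in Icc 0 τ, (∫ x in K, |w t x| ^ r) * |1 - t / τ| ^ k := by
    rw [← integral_const_mul]
    refine integral_mono
      (((cU.abs.rpow_const fun _ => Or.inr hr0.le).mul cη).continuousOn.integrableOn_compact
        isCompact_Icc)
      ((continuous_const.mul (cW.mul cη)).continuousOn.integrableOn_compact isCompact_Icc)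
      fun t => ?_
    have := mul_le_mul_of_nonneg_right (hpt t) (by positivity : 0 ≤ |1 - t / τ| ^ k)
    linarith
  have hY : 0 ≤ ∫ t in Icc 0 τ, (∫ x in K, |w t x| ^ r) * |1 - t / τ| ^ k :=
    integral_nonneg fun t => mul_nonneg (integral_nonneg fun x => by positivity) (by positivity)
  calc _ ≤ (D * τ ^ (-a)) ^ r * τ ^ (r - 1) * ((V * τ ^ (m + 1)) ^ (r - 1) *
        ∫ t in Icc 0 τ, (∫ x in K, |w t x| ^ r) * |1 - t / τ| ^ k) := by gcongr
    _ = _ := by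
      have e : τ ^ (-a * r + (m + 2) * (r - 1)) =
          (τ ^ (-a)) ^ r * τ ^ (r - 1) * (τ ^ (m + 1)) ^ (r - 1) := by
        rw [← Real.rpow_natCast τ (m + 1), ← Real.rpow_mul hτ0.le, ← Real.rpow_mul hτ0.le,
          ← Real.rpow_add hτ0, ← Real.rpow_add hτ0]
        congr 1; push_cast; ring
      rw [e, Real.mul_rpow hD.le (by positivity), Real.mul_rpow hV0.le (by positivity)]
      ring

/-- Lower bound for the time-weighted `L^p` mass of a solution of `v_tt - Δv = f` with
nonnegative source, nonnegative initial position and initial velocity `ε v₁`. -/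
lemma exists_solution_mass_ge (m : ℕ) {R p : ℝ} (hR : 0 < R) (hp : 1 < p) (k : ℕ)
    {v₁ : EuclideanSpace ℝ (Fin (m + 1)) → ℝ} (hv₁c : Continuous v₁) (hv₁n : ∀ x, 0 ≤ v₁ x)
    (hv₁s : ∀ x, R < ‖x‖ → v₁ x = 0) (hv₁pos : 0 < ∫ x, v₁ x) :
    ∃ c : ℝ, 0 < c ∧ ∀ τ : ℝ, 4 ≤ τ → ∀ ε : ℝ, 0 < ε →
      ∀ v f : ℝ → EuclideanSpace ℝ (Fin (m + 1)) → ℝ,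
        ContDiff ℝ 2 (fun z : ℝ × EuclideanSpace ℝ (Fin (m + 1)) => v z.1 z.2) →
        Continuous (fun z : ℝ × EuclideanSpace ℝ (Fin (m + 1)) => f z.1 z.2) →
        (∀ t ∈ Set.Ico (0:ℝ) (2 * τ), ∀ x,
          deriv (deriv (fun s => v s x)) t - laplacian (v t) x = f t x) →
        (∀ t ∈ Set.Ico (0:ℝ) (2 * τ), ∀ x, R + t < ‖x‖ → v t x = 0) →
        (∀ t x, 0 ≤ f t x) → (∀ x, 0 ≤ v 0 x) → (∀ x, deriv (fun s => v s x) 0 = ε * v₁ x) →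
        c * ε ^ p * τ ^ ((m : ℝ) + 1 - m * p / 2) ≤
          ∫ t in Icc 0 τ, (∫ x in Metric.closedBall 0 (R + 2 * τ), |v t x| ^ p) *
            |1 - t / τ| ^ k := by
  obtain ⟨c, hc, hlow⟩ := exists_integral_rpow_ge m hR hp
  have hp0 : 0 < p := by linarith
  set I := ∫ x, v₁ x with hI
  refine ⟨c * (exp (-R) * I / 4) ^ p * (1 / 2) ^ k * (1 / 4), by positivity,
    fun τ hτ ε hε v f hv hf heq hsupp hf0 hv0 hv1 => ?_⟩
  have hτ0 : 0 < τ := by linarith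
  set K := Metric.closedBall (0 : EuclideanSpace ℝ (Fin (m + 1))) (R + 2 * τ) with hKdef
  have hK : IsCompact K := isCompact_closedBall _ _
  have hv' : ContDiff ℝ ((1 : ℕ) + 1) (fun z : ℝ × EuclideanSpace ℝ (Fin (m + 1)) => v z.1 z.2) :=
    hv.of_le (by norm_num)
  have hv1' : ContDiff ℝ ((0 : ℕ) + 1) (fun z : ℝ × EuclideanSpace ℝ (Fin (m + 1)) =>
      deriv (fun s => v s z.2) z.1) := (contDiff_deriv_time hv').of_le (by norm_num)
  have hvt : ∀ t, Continuous (v t) := fun t =>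
    hv.continuous.comp (by fun_prop : Continuous fun x : EuclideanSpace ℝ (Fin (m + 1)) => (t, x))
  have hmom : ∀ ω : EuclideanSpace ℝ (Fin (m + 1)), ‖ω‖ = 1 → ∀ t, 1 ≤ t → t ≤ τ →
      ε * (exp (-R) * I / 4) * exp t ≤ expMoment K ω v t := by
    intro ω hω t ht1 ht
    have hG1 : ε * (exp (-R) * I) ≤ expMoment K ω (fun t x => deriv (fun s => v s x) t) 0 := by
      have hIK : I = ∫ x in K, v₁ x := by
        refine (setIntegral_eq_integral_of_forall_compl_eq_zero fun x hx => hv₁s x ?_).symm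
        have : R + 2 * τ < ‖x‖ := by simpa [K] using hx
        linarith
      simp only [expMoment, hv1]
      rw [hIK, ← integral_const_mul, ← integral_const_mul]
      refine integral_mono
        ((continuous_const.mul (continuous_const.mul hv₁c)).continuousOn.integrableOn_compact hK)
        (((continuous_const.mul hv₁c).mul (by fun_prop)).continuousOn.integrableOn_compact hK)
        fun x => ?_
      by_cases hx : R < ‖x‖
      · simp [hv₁s x hx]
      · have h1 : exp (-R) ≤ exp (inner ℝ ω x) := by
          refine exp_le_exp.2 ?_
          have := neg_le_of_abs_le (abs_real_inner_le_norm ω x)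
          rw [hω] at this
          linarith
        have := mul_le_mul_of_nonneg_left h1 (mul_nonneg hε.le (hv₁n x))
        simp only
        linarith
    have h := sinh_lower_bound (τ := τ) (hasDerivAt_expMoment hK ω hv')
      (hasDerivAt_expMoment hK ω hv1')
      (fun s hs => by
        have h := expMoment_deriv_deriv (b := 0) hv hf (by simpa using heq) hsupp ω
          (⟨hs.1, by linarith [hs.2]⟩ : s ∈ Set.Ico (0:ℝ) (2 * τ))
        have h0 : 0 ≤ expMoment K ω f s :=
          integral_nonneg fun x => mul_nonneg (hf0 s x) (exp_pos _).le
        rw [hω] at h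
        linarith)
      (integral_nonneg fun x => mul_nonneg (hv0 x) (exp_pos _).le)
      ((by positivity : 0 ≤ ε * (exp (-R) * I)).trans hG1) ht1 ht
    refine le_trans ?_ h
    gcongr
    linarith
  have cV : Continuous fun t => ∫ x in K, |v t x| ^ p :=
    continuous_parametric_integral_of_continuous (f := fun t x => |v t x| ^ p)
      (hv.continuous.abs.rpow_const fun _ => Or.inr hp0.le) hK
  have cη : Continuous fun t : ℝ => |1 - t / τ| ^ k := by fun_prop
  set L := c * (ε * (exp (-R) * I / 4)) ^ p * τ ^ ((m : ℝ) - m * p / 2) with hL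
  have hpt : ∀ t ∈ Icc (τ / 4) (τ / 2), L * (1 / 2) ^ k ≤
      (∫ x in K, |v t x| ^ p) * |1 - t / τ| ^ k := by
    intro t ht
    have htT : t ∈ Set.Ico (0:ℝ) (2 * τ) := ⟨by linarith [ht.1], by linarith [ht.2]⟩
    have hsub : Metric.closedBall (0 : EuclideanSpace ℝ (Fin (m + 1))) (R + t) ⊆ K :=
      Metric.closedBall_subset_closedBall (by linarith [htT.2])
    have h1 := hlow τ hτ t ht (ε * (exp (-R) * I / 4)) (by positivity) (v t) (hvt t)
      (fun ω hω => by
        refine (hmom ω hω t (by linarith [ht.1]) (by linarith [ht.2])).trans (le_of_eq ?_)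
        refine setIntegral_eq_of_subset_of_forall_sdiff_eq_zero hK.measurableSet hsub fun x hx => ?_
        rw [hsupp t htT x (by simpa using hx.2), zero_mul])
    have h2 : ∫ x in Metric.closedBall 0 (R + t), |v t x| ^ p ≤ ∫ x in K, |v t x| ^ p :=
      setIntegral_mono_set
        (((hvt t).abs.rpow_const fun _ => Or.inr hp0.le).continuousOn.integrableOn_compact hK)
        (Filter.Eventually.of_forall fun x => by positivity) hsub.eventuallyLE
    have h3 : (1 : ℝ) / 2 ≤ |1 - t / τ| := by
      refine le_trans ?_ (le_abs_self _)
      have : t / τ ≤ 1 / 2 := by rw [div_le_iff₀ hτ0]; linarith [ht.2]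
      linarith
    have hL0 : 0 ≤ L := by positivity
    gcongr
    exact h1.trans h2
  have hsub : Icc (τ / 4) (τ / 2) ⊆ Icc 0 τ := Icc_subset_Icc (by linarith) (by linarith)
  calc _ = ∫ t in Icc (τ / 4) (τ / 2), L * (1 / 2) ^ k := by
        rw [setIntegral_const, Real.volume_real_Icc_of_le (by linarith), smul_eq_mul, hL,
          Real.mul_rpow hε.le (by positivity),
          show (m : ℝ) + 1 - m * p / 2 = (m - m * p / 2) + 1 by ring, Real.rpow_add_one hτ0.ne']
        ring
    _ ≤ ∫ t in Icc (τ / 4) (τ / 2), (∫ x in K, |v t x| ^ p) * |1 - t / τ| ^ k :=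
        setIntegral_mono_on (continuous_const.continuousOn.integrableOn_compact isCompact_Icc)
          ((cV.mul cη).continuousOn.integrableOn_compact isCompact_Icc) measurableSet_Icc hpt
    _ ≤ _ := setIntegral_mono_set ((cV.mul cη).continuousOn.integrableOn_compact isCompact_Icc)
        (Filter.Eventually.of_forall fun t =>
          mul_nonneg (integral_nonneg fun x => by positivity) (by positivity)) hsub.eventuallyLE

lemma le_rpow_of_rpow_le_of_rpow_le {p q A B Z W : ℝ} (hq : 0 < q) (hpq : 1 < p * q)
    (hA : 0 ≤ A) (hB : 0 ≤ B) (hZ : 0 ≤ Z) (hW : 0 ≤ W) (h1 : Z ^ p ≤ A * W)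
    (h2 : W ^ q ≤ B * Z) : Z ≤ (A ^ q * B) ^ (1 / (p * q - 1)) := by
  have hd : 0 < p * q - 1 := by linarith
  rcases hZ.eq_or_lt with rfl | hZ
  · positivity
  have h3 : Z ^ (p * q - 1) * Z ≤ A ^ q * B * Z := by
    rw [← Real.rpow_add_one hZ.ne', sub_add_cancel, Real.rpow_mul hZ.le]
    calc (Z ^ p) ^ q ≤ (A * W) ^ q := by gcongr
      _ = A ^ q * W ^ q := Real.mul_rpow hA hW
      _ ≤ A ^ q * (B * Z) := by gcongr
      _ = _ := by ring
  have h4 := le_of_mul_le_mul_right h3 hZ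
  rw [one_div]
  exact (Real.le_rpow_inv_iff_of_pos hZ.le (by positivity) hd).2 h4

lemma le_mul_rpow_of_le_mul_rpow_neg {C F F' ε τ : ℝ} (hC : 0 < C) (hF : 0 < F) (hF' : F ≤ F')
    (hε : 0 < ε) (hε1 : ε ≤ 1) (hτ : 0 < τ) (h : ε ≤ C * τ ^ (-F')) :
    τ ≤ C ^ (1 / F') * ε ^ (-1 / F) := by
  have hF0 : 0 < F' := by linarith
  have h1 : τ ^ F' ≤ C * ε⁻¹ := by
    rw [Real.rpow_neg hτ.le, ← div_eq_mul_inv, le_div_iff₀ (by positivity)] at h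
    rw [← div_eq_mul_inv, le_div_iff₀ hε]
    linarith
  have h2 : τ ≤ (C * ε⁻¹) ^ F'⁻¹ := (Real.le_rpow_inv_iff_of_pos hτ.le (by positivity) hF0).2 h1
  refine h2.trans ?_
  rw [Real.mul_rpow hC.le (by positivity), one_div, ← Real.rpow_neg_one ε, ← Real.rpow_mul hε.le]
  gcongr ?_ * ?_
  refine Real.rpow_le_rpow_of_exponent_ge hε hε1 ?_
  rw [neg_one_mul, neg_div, one_div]
  gcongr

/-- Solutions existing up to time `2 τ` must have small data. -/
lemma exists_data_size_le (m : ℕ) {p q : ℝ} (hp : 1 < p) (hq : 1 < q) {R : ℝ} (hR : 0 < R)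
    {u₀ u₁ v₀ v₁ : EuclideanSpace ℝ (Fin (m + 1)) → ℝ} (hv₁c : Continuous v₁)
    (hu₀n : ∀ x, 0 ≤ u₀ x) (hu₁n : ∀ x, 0 ≤ u₁ x) (hv₀n : ∀ x, 0 ≤ v₀ x) (hv₁n : ∀ x, 0 ≤ v₁ x)
    (hv₁s : ∀ x, R < ‖x‖ → v₁ x = 0) (hv₁ne : v₁ ≠ 0) :
    ∃ C > (0:ℝ), ∃ C' > (0:ℝ), ∀ ε : ℝ, 0 < ε → ∀ τ : ℝ, 4 ≤ τ →
      ∀ u v : ℝ → EuclideanSpace ℝ (Fin (m + 1)) → ℝ,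
        IsNakaoSolution p q (2 * τ) u v →
        (∀ x, u 0 x = ε * u₀ x) → (∀ x, deriv (fun s => u s x) 0 = ε * u₁ x) →
        (∀ x, v 0 x = ε * v₀ x) → (∀ x, deriv (fun s => v s x) 0 = ε * v₁ x) →
        (∀ t ∈ Set.Ico (0:ℝ) (2 * τ), ∀ x, R + t < ‖x‖ → u t x = 0) →
        (∀ t ∈ Set.Ico (0:ℝ) (2 * τ), ∀ x, R + t < ‖x‖ → v t x = 0) →
        ε ≤ C * τ ^ (-((2 + 1 / p) / (p * q - 1) - (m : ℝ) / 2)) ∧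
        ε ≤ C' * τ ^ (-(q * ((1 + 2 / q) / (p * q - 1) - (m : ℝ) / q))) := by
  have hp0 : 0 < p := by linarith
  have hq0 : 0 < q := by linarith
  have hpq : 1 < p * q := one_lt_mul_of_lt_of_le hp hq.le
  have hpq' : 0 < p * q - 1 := by linarith
  have hv₁supp : HasCompactSupport v₁ :=
    HasCompactSupport.intro (isCompact_closedBall 0 R) fun x hx => hv₁s x (by simpa using hx)
  have hI : 0 < ∫ x, v₁ x := by
    obtain ⟨x, hx⟩ := Function.ne_iff.1 hv₁ne
    exact hv₁c.integral_pos_of_hasCompactSupport_nonneg_nonzero hv₁supp hv₁n hx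
  obtain ⟨k, hk⟩ := exists_nat_ge (max (2 * p / (p - 1)) (2 * q / (q - 1)))
  have hkp : 2 * p ≤ k * (p - 1) :=
    (div_le_iff₀ (by linarith)).1 ((le_max_left _ _).trans hk)
  have hkq : 2 * q ≤ k * (q - 1) :=
    (div_le_iff₀ (by linarith)).1 ((le_max_right _ _).trans hk)
  obtain ⟨A, hA, hu_mass⟩ := exists_source_mass_le m (b := 1) (a := 1) (D := k ^ 2 + k + 1) hR hq
    zero_le_one (by positivity) hkq
  obtain ⟨B, hB, hv_mass⟩ := exists_source_mass_le m (b := 0) (a := 2) (D := k ^ 2 + 1) hR hp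
    le_rfl (by positivity) hkp
  obtain ⟨c, hc, hlow⟩ := exists_solution_mass_ge m hR hp k hv₁c hv₁n hv₁s hI
  set I := ∫ x, v₁ x with hIdef
  refine ⟨((A ^ p * B) ^ (1 / (p * q - 1)) / c) ^ (1 / p), by positivity,
    (B ^ q * A) ^ (1 / (p * q - 1)) / I, by positivity,
    fun ε hε τ hτ u v ⟨hu, hv, equ, eqv⟩ hu0 hu1 hv0 hv1 hus hvs => ?_⟩
  have hτ0 : 0 < τ := by linarith
  have hfu : Continuous fun z : ℝ × EuclideanSpace ℝ (Fin (m + 1)) => |v z.1 z.2| ^ p :=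
    hv.continuous.abs.rpow_const fun _ => Or.inr hp0.le
  have hfv : Continuous fun z : ℝ × EuclideanSpace ℝ (Fin (m + 1)) => |u z.1 z.2| ^ q :=
    hu.continuous.abs.rpow_const fun _ => Or.inr hq0.le
  have h1 := hu_mass τ (by linarith)
    (by
      rw [Real.rpow_neg_one, ← div_eq_mul_inv, div_add_div _ _ (by positivity) (by positivity),
        div_le_div_iff₀ (by positivity) (by positivity)]
      have : (k : ℝ) ^ 2 * τ ^ 2 ≤ k ^ 2 * τ ^ 3 := by gcongr <;> linarith
      nlinarith [pow_pos hτ0 3])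
    u (fun t x => |v t x| ^ p) hu hfu (by simpa using equ) hus (fun t x => by positivity)
    (fun x => by rw [hu0]; exact mul_nonneg hε.le (hu₀n x))
    (fun x => by rw [hu1]; exact mul_nonneg hε.le (hu₁n x))
  have h2 := hv_mass τ (by linarith)
    (by
      rw [Real.rpow_neg hτ0.le, Real.rpow_two, ← div_eq_mul_inv, zero_mul, zero_div, add_zero]
      gcongr
      linarith)
    v (fun t x => |u t x| ^ q) hv hfv (by simpa using eqv) hvs (fun t x => by positivity)
    (fun x => by rw [hv0]; exact mul_nonneg hε.le (hv₀n x))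
    (fun x => by rw [hv1]; exact mul_nonneg hε.le (hv₁n x))
  have h3 := hlow τ hτ ε hε v (fun t x => |u t x| ^ q) hv hfv eqv hvs (fun t x => by positivity)
    (fun x => by rw [hv0]; exact mul_nonneg hε.le (hv₀n x)) hv1
  have hIK : ∫ x in Metric.closedBall 0 (R + 2 * τ), deriv (fun s => v s x) 0 = ε * I := by
    simp only [hv1]
    rw [integral_const_mul, setIntegral_eq_integral_of_forall_compl_eq_zero fun x hx => hv₁s x ?_]
    have : R + 2 * τ < ‖x‖ := by simpa using hx
    linarith
  rw [hIK] at h2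
  have hJ : 0 ≤ ∫ x in Metric.closedBall 0 (R + 2 * τ), deriv (fun s => u s x) 0 :=
    integral_nonneg fun x => by rw [hu1]; exact mul_nonneg hε.le (hu₁n x)
  have hX0 : 0 ≤ ∫ t in Icc 0 τ, (∫ x in Metric.closedBall 0 (R + 2 * τ), |v t x| ^ p) *
      |1 - t / τ| ^ k :=
    integral_nonneg fun t => mul_nonneg (integral_nonneg fun x => by positivity) (by positivity)
  have hY0 : 0 ≤ ∫ t in Icc 0 τ, (∫ x in Metric.closedBall 0 (R + 2 * τ), |u t x| ^ q) *
      |1 - t / τ| ^ k :=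
    integral_nonneg fun t => mul_nonneg (integral_nonneg fun x => by positivity) (by positivity)
  generalize (∫ t in Icc 0 τ, (∫ x in Metric.closedBall 0 (R + 2 * τ), |v t x| ^ p) *
    |1 - t / τ| ^ k) = X at h1 h2 h3 hX0
  generalize (∫ t in Icc 0 τ, (∫ x in Metric.closedBall 0 (R + 2 * τ), |u t x| ^ q) *
    |1 - t / τ| ^ k) = Y at h1 h2 hY0
  have h1' : X ^ q ≤ A * τ ^ (-1 * q + (m + 2) * (q - 1)) * Y :=
    (Real.rpow_le_rpow hX0 (by linarith) hq0.le).trans h1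
  have hεI : 0 < ε * I := by positivity
  constructor
  · have h2' : Y ^ p ≤ B * τ ^ (-2 * p + (m + 2) * (p - 1)) * X :=
      (Real.rpow_le_rpow hY0 (by linarith) hp0.le).trans h2
    have h4 := le_rpow_of_rpow_le_of_rpow_le hp0 (by linarith) (by positivity) (by positivity)
      hX0 hY0 h1' h2'
    have e : ((A * τ ^ (-1 * q + (m + 2) * (q - 1))) ^ p *
        (B * τ ^ (-2 * p + (m + 2) * (p - 1)))) ^ (1 / (q * p - 1)) =
        (A ^ p * B) ^ (1 / (p * q - 1)) * τ ^ ((m : ℝ) + 1 - m * p / 2) *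
          (τ ^ (-((2 + 1 / p) / (p * q - 1) - (m : ℝ) / 2))) ^ p := by
      rw [Real.mul_rpow hA.le (by positivity), mul_mul_mul_comm, ← Real.rpow_mul hτ0.le,
        ← Real.rpow_add hτ0, Real.mul_rpow (by positivity) (by positivity), mul_comm q p,
        ← Real.rpow_mul hτ0.le, ← Real.rpow_mul hτ0.le, mul_assoc, ← Real.rpow_add hτ0]
      congr 2
      obtain ⟨d, hd⟩ : ∃ d, d = p * q - 1 := ⟨_, rfl⟩
      rw [← hd] at hpq' ⊢
      field_simp
      linear_combination -(2 * (m : ℝ) + 2) * hd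
    have h5 := h3.trans h4
    rw [e, mul_right_comm (_ ^ (1 / (p * q - 1)))] at h5
    have h6 := le_of_mul_le_mul_right h5 (by positivity)
    rw [← Real.rpow_le_rpow_iff hε.le (by positivity) hp0,
      Real.mul_rpow (by positivity) (by positivity), ← Real.rpow_mul (by positivity),
      one_div_mul_cancel hp0.ne', Real.rpow_one, div_mul_eq_mul_div, le_div_iff₀ hc]
    linarith
  · have hle : A * τ ^ (-1 * q + (m + 2) * (q - 1)) * Y ≤
        A * τ ^ (-1 * q + (m + 2) * (q - 1)) * (Y + ε * I) := by
      gcongr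
      linarith
    have h4 := le_rpow_of_rpow_le_of_rpow_le hq0 hpq (by positivity) (by positivity)
      (by positivity) hX0 h2 (h1'.trans hle)
    have e : ((B * τ ^ (-2 * p + (m + 2) * (p - 1))) ^ q *
        (A * τ ^ (-1 * q + (m + 2) * (q - 1)))) ^ (1 / (p * q - 1)) =
        (B ^ q * A) ^ (1 / (p * q - 1)) *
          τ ^ (-(q * ((1 + 2 / q) / (p * q - 1) - (m : ℝ) / q))) := by
      rw [Real.mul_rpow hB.le (by positivity), mul_mul_mul_comm, ← Real.rpow_mul hτ0.le,
        ← Real.rpow_add hτ0, Real.mul_rpow (by positivity) (by positivity),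
        ← Real.rpow_mul hτ0.le]
      congr 2
      field_simp
      ring
    rw [e] at h4
    rw [div_mul_eq_mul_div, le_div_iff₀ hI]
    linarith
theorem nakao_blowup_prop1 {n : ℕ} (hn : 1 ≤ n) {p q : ℝ} (hp : 1 < p) (hq : 1 < q)
    (hpn : 3 ≤ n → p ≤ (n : ℝ) / ((n : ℝ) - 2)) (hqn : 3 ≤ n → q ≤ (n : ℝ) / ((n : ℝ) - 2))
    (hcond : max ((q / 2 + 1) / (p * q - 1)) ((2 + 1 / p) / (p * q - 1)) > ((n : ℝ) - 1) / 2)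
    {R : ℝ} (hR : 0 < R) (u₀ u₁ v₀ v₁ : EuclideanSpace ℝ (Fin n) → ℝ)
    (hu₀c : Continuous u₀) (hu₁c : Continuous u₁) (hv₀c : Continuous v₀) (hv₁c : Continuous v₁)
    (hu₀n : ∀ x, 0 ≤ u₀ x) (hu₁n : ∀ x, 0 ≤ u₁ x) (hv₀n : ∀ x, 0 ≤ v₀ x) (hv₁n : ∀ x, 0 ≤ v₁ x)
    (hu₀s : ∀ x, R < ‖x‖ → u₀ x = 0) (hu₁s : ∀ x, R < ‖x‖ → u₁ x = 0)
    (hv₀s : ∀ x, R < ‖x‖ → v₀ x = 0) (hv₁s : ∀ x, R < ‖x‖ → v₁ x = 0)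
    (hu₀ne : u₀ ≠ 0) (hv₁ne : v₁ ≠ 0) :
    ∃ ε₀ > (0:ℝ), ∃ C > (0:ℝ), ∀ ε : ℝ, 0 < ε → ε ≤ ε₀ → ∀ T > (0:ℝ),
      ∀ u v : ℝ → EuclideanSpace ℝ (Fin n) → ℝ,
        IsNakaoSolution p q T u v →
        (∀ x, u 0 x = ε * u₀ x) → (∀ x, deriv (fun s => u s x) 0 = ε * u₁ x) →
        (∀ x, v 0 x = ε * v₀ x) → (∀ x, deriv (fun s => v s x) 0 = ε * v₁ x) →
        (∀ t ∈ Set.Ico (0:ℝ) T, ∀ x, R + t < ‖x‖ → u t x = 0) →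
        (∀ t ∈ Set.Ico (0:ℝ) T, ∀ x, R + t < ‖x‖ → v t x = 0) →
        T ≤ C * ε ^ (-1 / max ((2 + 1 / p) / (p * q - 1) - ((n : ℝ) - 1) / 2)
                            ((1 + 2 / q) / (p * q - 1) - ((n : ℝ) - 1) / q)) := by
  obtain ⟨m, rfl⟩ := Nat.exists_eq_add_of_le' hn
  obtain ⟨C, hC, C', hC', hsize⟩ :=
    exists_data_size_le m hp hq hR hv₁c hu₀n hu₁n hv₀n hv₁n hv₁s hv₁ne
  have hq0 : 0 < q := by linarith
  have hpq : 0 < p * q - 1 := by nlinarith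
  have hm : ((m + 1 : ℕ) : ℝ) - 1 = m := by push_cast; ring
  rw [hm] at hcond ⊢
  set F₁ := (2 + 1 / p) / (p * q - 1) - (m : ℝ) / 2 with hF₁
  set F₂ := (1 + 2 / q) / (p * q - 1) - (m : ℝ) / q with hF₂
  have hF : 0 < max F₁ F₂ := by
    rcases lt_max_iff.1 hcond with h | h
    · have e : F₂ = 2 / q * ((q / 2 + 1) / (p * q - 1) - (m : ℝ) / 2) := by
        rw [hF₂]; field_simp
      have : 0 < F₂ := by
        rw [e]; exact mul_pos (by positivity) (by linarith)
      exact lt_max_of_lt_right this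
    · exact lt_max_of_lt_left (by linarith)
  refine ⟨1, one_pos, 8 + 2 * (C ^ (1 / F₁)) + 2 * (C' ^ (1 / (q * F₂))), by positivity,
    fun ε hε hε1 T hT u v hsol hu0 hu1 hv0 hv1 hus hvs => ?_⟩
  have hE : 1 ≤ ε ^ (-1 / max F₁ F₂) :=
    Real.one_le_rpow_of_pos_of_le_one_of_nonpos hε hε1
      (div_nonpos_of_nonpos_of_nonneg (by norm_num) hF.le)
  have hC1 : 0 < C ^ (1 / F₁) := by positivity
  have hC2 : 0 < C' ^ (1 / (q * F₂)) := by positivity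
  rcases lt_or_ge T 8 with hT8 | hT8
  · nlinarith
  obtain ⟨τ, rfl⟩ : ∃ τ, T = 2 * τ := ⟨T / 2, by ring⟩
  obtain ⟨h1, h2⟩ := hsize ε hε τ (by linarith) u v hsol hu0 hu1 hv0 hv1 hus hvs
  rcases le_total F₂ F₁ with h | h
  · rw [max_eq_left h] at hF hE ⊢
    have := le_mul_rpow_of_le_mul_rpow_neg hC hF le_rfl hε hε1 (by linarith) h1
    nlinarith
  · rw [max_eq_right h] at hF hE ⊢
    have := le_mul_rpow_of_le_mul_rpow_neg hC' hF (by nlinarith) hε hε1 (by linarith) h2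
    nlinarith
end

section
/- Let n ≥ 1 be an integer, and let p, q > 1 be reals, with the additional restriction p, q ≤ n/(n-2) when n ≥ 3. Assume max{(q/2 + 1)/(pq - 1), (1/2 + p)/(pq - 1) - 1/2} > (n-1)/2. Let u₀, u₁, v₀, v₁ : ℝⁿ → ℝ be continuous, nonnegative, supported in the closed ball B_R of radius R > 0, with u₀ and v₁ not identically zero. Then there exist constants ε₀ > 0 and C > 0 (depending only on u₀, u₁, v₀, v₁, n, p, q, R) such that for every ε ∈ (0, ε₀] and every T > 0: if (u, v) is a classical solution of the system u_tt - Δu + u_t = |v|^p, v_tt - Δv = |u|^q on [0,T) × ℝⁿ with initial data (u, u_t, v, v_t)(0,·) = ε(u₀, u₁, v₀, v₁) and with supp u, supp v contained in {(t,x) : |x| ≤ R + t}, then T ≤ C ε^{-1/max{F₃(n,p,q), F₄(n,p,q)}}, where F₃(n,p,q) := (2 + q)/(pq - 1) - n + 1 and F₄(n,p,q) := (1 + 2p)/(pq - 1) - n. -/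
open Real Set

section TestFunction

open MeasureTheory Metric

variable {n : ℕ}

theorem ContDiff.hasDerivAt_slice_fst {E : Type*} [NormedAddCommGroup E] [NormedSpace ℝ E]
    {G : ℝ × E → ℝ} (hG : ContDiff ℝ 1 G) (t : ℝ) (x : E) :
    HasDerivAt (fun s => G (s, x)) (fderiv ℝ G (t, x) (1, 0)) t :=
  ((hG.differentiable one_ne_zero (t, x)).hasFDerivAt).comp_hasDerivAt t
    ((hasDerivAt_id t).prodMk (hasDerivAt_const t x))

theorem ContDiff.fderiv_slice_snd {E : Type*} [NormedAddCommGroup E] [NormedSpace ℝ E]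
    {G : ℝ × E → ℝ} (hG : ContDiff ℝ 1 G) (t : ℝ) (x e : E) :
    fderiv ℝ (fun y => G (t, y)) x e = fderiv ℝ G (t, x) (0, e) := by
  have h := ((hG.differentiable one_ne_zero (t, x)).hasFDerivAt).comp x
    ((hasFDerivAt_const t x).prodMk (hasFDerivAt_id x))
  have h' : fderiv ℝ (fun y => G (t, y)) x = _ := h.fderiv
  simp [h']

theorem continuous_laplacian_slice {u : ℝ → EuclideanSpace ℝ (Fin n) → ℝ}
    (hu : ContDiff ℝ 2 (fun z : ℝ × EuclideanSpace ℝ (Fin n) => u z.1 z.2)) :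
    Continuous (fun z : ℝ × EuclideanSpace ℝ (Fin n) => laplacian (u z.1) z.2) := by
  unfold laplacian
  refine continuous_finsetSum _ fun i _ => ?_
  set G := fun z : ℝ × EuclideanSpace ℝ (Fin n) => u z.1 z.2
  set e : EuclideanSpace ℝ (Fin n) := EuclideanSpace.single i 1
  have hG1 : ContDiff ℝ 1 (fun z => fderiv ℝ G z (0, e)) :=
    (hu.fderiv_right (m := 1) (by norm_num)).clm_apply contDiff_const
  have h1 : ∀ (t : ℝ) y, fderiv ℝ (u t) y e = fderiv ℝ G (t, y) (0, e) :=
    fun t y => (hu.of_le (by norm_num)).fderiv_slice_snd t y e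
  have h2 : ∀ z : ℝ × EuclideanSpace ℝ (Fin n),
      fderiv ℝ (fun y => fderiv ℝ (u z.1) y e) z.2 e
        = fderiv ℝ (fun z => fderiv ℝ G z (0, e)) z (0, e) := by
    intro z
    simp_rw [h1]
    exact hG1.fderiv_slice_snd z.1 z.2 e
  simp_rw [h2]
  exact (hG1.continuous_fderiv one_ne_zero).clm_apply continuous_const

theorem integral_fderiv_apply_eq_zero {f : EuclideanSpace ℝ (Fin n) → ℝ} (hf : ContDiff ℝ 1 f)
    (hc : HasCompactSupport f) (e : EuclideanSpace ℝ (Fin n)) :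
    ∫ x, fderiv ℝ f x e = 0 := by
  have hf' : Continuous (fun x => fderiv ℝ f x e) :=
    (hf.continuous_fderiv one_ne_zero).clm_apply continuous_const
  have := integral_mul_fderiv_eq_neg_fderiv_mul_of_integrable (μ := volume)
    (f := fun _ : EuclideanSpace ℝ (Fin n) => (1 : ℝ)) (g := f) (v := e)
    (by simp)
    (by simpa using hf'.integrable_of_hasCompactSupport (hc.fderiv_apply ℝ e))
    (by simpa using hf.continuous.integrable_of_hasCompactSupport hc)
    (fun x _ => by fun_prop) (fun x _ => hf.differentiable one_ne_zero x)
  simpa using this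

theorem setIntegral_laplacian_eq_zero {f : EuclideanSpace ℝ (Fin n) → ℝ} (hf : ContDiff ℝ 2 f)
    {r : ℝ} (hs : ∀ x, r < ‖x‖ → f x = 0) :
    ∫ x in closedBall 0 r, laplacian f x = 0 := by
  have hsub : tsupport f ⊆ closedBall 0 r := by
    refine closure_minimal (fun x hx => ?_) isClosed_closedBall
    rw [mem_closedBall_zero_iff]
    by_contra! h
    exact hx (hs x h)
  have hc : HasCompactSupport f :=
    (isCompact_closedBall 0 r).of_isClosed_subset (isClosed_tsupport f) hsub
  have hC1 : ∀ e, ContDiff ℝ 1 (fun y => fderiv ℝ f y e) := fun e =>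
    (hf.fderiv_right (m := 1) (by norm_num)).clm_apply contDiff_const
  have hcont : ∀ e, Continuous (fun x => fderiv ℝ (fun y => fderiv ℝ f y e) x e) := fun e =>
    ((hC1 e).continuous_fderiv one_ne_zero).clm_apply continuous_const
  have hcomp : ∀ e, HasCompactSupport (fun x => fderiv ℝ (fun y => fderiv ℝ f y e) x e) :=
    fun e => (hc.fderiv_apply ℝ e).fderiv_apply ℝ e
  rw [setIntegral_eq_integral_of_forall_compl_eq_zero]
  · unfold laplacian
    rw [integral_finsetSum _ fun i _ => (hcont _).integrable_of_hasCompactSupport (hcomp _)]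
    exact Finset.sum_eq_zero fun i _ =>
      integral_fderiv_apply_eq_zero (hC1 _) (hc.fderiv_apply ℝ _) _
  · intro x hx
    refine Finset.sum_eq_zero fun i _ => ?_
    have h1 := tsupport_fderiv_apply_subset ℝ (f := f) (EuclideanSpace.single i (1 : ℝ))
    have h2 := tsupport_fderiv_apply_subset ℝ
      (f := fun y => fderiv ℝ f y (EuclideanSpace.single i (1 : ℝ)))
      (EuclideanSpace.single i (1 : ℝ))
    exact image_eq_zero_of_notMem_tsupport
      (f := fun x => fderiv ℝ (fun y => fderiv ℝ f y (EuclideanSpace.single i (1 : ℝ))) x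
        (EuclideanSpace.single i (1 : ℝ))) fun h => hx (hsub (h1 (h2 h)))

/-- Lebesgue measure on the space-time cylinder `[0, S] × closedBall 0 r`. -/
noncomputable def cylinderMeasure (n : ℕ) (S r : ℝ) : Measure (ℝ × EuclideanSpace ℝ (Fin n)) :=
  (volume.restrict (Icc 0 S)).prod (volume.restrict (closedBall 0 r))

theorem cylinderMeasure_eq_restrict (n : ℕ) (S r : ℝ) :
    cylinderMeasure n S r = volume.restrict (Icc 0 S ×ˢ closedBall 0 r) :=
  Measure.prod_restrict _ _

theorem Continuous.integrable_cylinderMeasure {S r : ℝ}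
    {F : ℝ × EuclideanSpace ℝ (Fin n) → ℝ} (hF : Continuous F) :
    Integrable F (cylinderMeasure n S r) := by
  rw [cylinderMeasure_eq_restrict]
  exact hF.continuousOn.integrableOn_compact (isCompact_Icc.prod (isCompact_closedBall 0 r))

theorem ae_cylinderMeasure_fst_mem (n : ℕ) (S r : ℝ) :
    ∀ᵐ z ∂cylinderMeasure n S r, z.1 ∈ Icc (0 : ℝ) S := by
  rw [cylinderMeasure_eq_restrict]
  filter_upwards [ae_restrict_mem (measurableSet_Icc.prod isClosed_closedBall.measurableSet)]
    with z hz using hz.1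

theorem cylinderMeasure_univ_le {R : ℝ} (hR : 0 < R) {S : ℝ} (hS : 1 ≤ S) :
    (cylinderMeasure n S (R + S)).real univ
      ≤ (1 + R) ^ n * volume.real (closedBall (0 : EuclideanSpace ℝ (Fin n)) 1) * S ^ (n + 1) := by
  have h : (cylinderMeasure n S (R + S)).real univ
      = S * ((R + S) ^ n * volume.real (closedBall (0 : EuclideanSpace ℝ (Fin n)) 1)) := by
    rw [cylinderMeasure, ← univ_prod_univ, measureReal_prod_prod]
    simp only [measureReal_restrict_apply_univ]
    rw [Measure.addHaar_real_closedBall' _ _ (by linarith)]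
    simp [measureReal_def, Real.volume_Icc, le_trans zero_le_one hS]
  rw [h]
  have h1 : (R + S) ^ n ≤ ((1 + R) * S) ^ n := by
    gcongr
    nlinarith
  calc _ ≤ S * (((1 + R) * S) ^ n * volume.real (closedBall (0 : EuclideanSpace ℝ (Fin n)) 1)) := by
        gcongr
    _ = _ := by rw [mul_pow]; ring

instance (n : ℕ) (S r : ℝ) : IsFiniteMeasure (cylinderMeasure n S r) := by
  rw [cylinderMeasure_eq_restrict]
  exact ⟨by
    rw [Measure.restrict_apply_univ]
    exact (isCompact_Icc.prod (isCompact_closedBall 0 r)).measure_lt_top⟩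

/-- Integration by parts in time against the cutoff `(1 - t / S) ^ (m + 2)`. -/
theorem integral_mul_cutoff_le {f f' f'' : ℝ → ℝ} (hf : ∀ t, HasDerivAt f (f' t) t)
    (hf' : ∀ t, HasDerivAt f' (f'' t) t) (hf'' : Continuous f'') (h0 : 0 ≤ f 0)
    {δ S : ℝ} (hδ : 0 ≤ δ) (hS : 0 < S) (m : ℕ) :
    (∫ t in Icc 0 S, (f'' t + δ * f' t) * (1 - t / S) ^ (m + 2)) + (f' 0 + δ * f 0)
      ≤ ((m + 2) * (m + 1) / S ^ 2 + δ * (m + 2) / S) * ∫ t in Icc 0 S, |f t| * (1 - t / S) ^ m := by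
  have cf : Continuous f := continuous_iff_continuousAt.2 fun t => (hf t).continuousAt
  have cf' : Continuous f' := continuous_iff_continuousAt.2 fun t => (hf' t).continuousAt
  simp only [integral_Icc_eq_integral_Ioc, ← intervalIntegral.integral_of_le hS.le]
  have hτ : ∀ (k : ℕ) (t : ℝ), HasDerivAt (fun t => (1 - t / S) ^ (k + 1))
      (-(((k : ℝ) + 1) / S) * (1 - t / S) ^ k) t := by
    intro k t
    have := (((hasDerivAt_id t).div_const S).const_sub 1).pow (k + 1)
    refine this.congr_deriv ?_
    simp
    ring
  have hD : ∀ t, HasDerivAt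
      (fun t => (f' t + δ * f t) * (1 - t / S) ^ (m + 1 + 1)
        + ((m : ℝ) + 2) / S * (f t * (1 - t / S) ^ (m + 1)))
      ((f'' t + δ * f' t) * (1 - t / S) ^ (m + 2)
        - f t * (((m : ℝ) + 2) * (m + 1) / S ^ 2 + δ * (m + 2) / S * (1 - t / S))
          * (1 - t / S) ^ m) t := by
    intro t
    refine ((((hf' t).add ((hf t).const_mul δ)).mul (hτ (m + 1) t)).add
      (((hf t).mul (hτ m t)).const_mul (((m : ℝ) + 2) / S))).congr_deriv ?_
    push_cast
    simp only [Pi.add_apply]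
    generalize 1 - t / S = τ
    ring
  have hint := intervalIntegral.integral_eq_sub_of_hasDerivAt (a := 0) (b := S)
    (fun t _ => hD t) (Continuous.intervalIntegrable (by fun_prop) _ _)
  rw [intervalIntegral.integral_sub (Continuous.intervalIntegrable (by fun_prop) _ _)
    (Continuous.intervalIntegrable (by fun_prop) _ _)] at hint
  simp only [div_self hS.ne', sub_self, zero_div, sub_zero, one_pow, mul_one] at hint
  simp only [ne_eq, Nat.add_eq_zero_iff, one_ne_zero, and_false, not_false_eq_true, zero_pow,
    mul_zero, add_zero, zero_sub] at hint
  have hle : ∫ t in (0 : ℝ)..S, f t * (((m : ℝ) + 2) * (m + 1) / S ^ 2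
      + δ * (m + 2) / S * (1 - t / S)) * (1 - t / S) ^ m
      ≤ ∫ t in (0 : ℝ)..S, ((m + 2) * (m + 1) / S ^ 2 + δ * (m + 2) / S)
        * (|f t| * (1 - t / S) ^ m) := by
    refine intervalIntegral.integral_mono_on hS.le
      (Continuous.intervalIntegrable (by fun_prop) _ _)
      (Continuous.intervalIntegrable (by fun_prop) _ _) fun t ht => ?_
    have h1 : t / S ≤ 1 := (div_le_one hS).2 ht.2
    have h2 : 0 ≤ t / S := div_nonneg ht.1 hS.le
    have h3 : 0 ≤ 1 - t / S := by linarith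
    have h4 : f t * (((m : ℝ) + 2) * (m + 1) / S ^ 2 + δ * (m + 2) / S * (1 - t / S))
        ≤ |f t| * (((m : ℝ) + 2) * (m + 1) / S ^ 2 + δ * (m + 2) / S * 1) := by
      refine mul_le_mul (le_abs_self _) ?_ (by positivity) (abs_nonneg _)
      gcongr
      linarith
    calc _ ≤ _ := mul_le_mul_of_nonneg_right h4 (pow_nonneg h3 m)
      _ = _ := by ring
  rw [intervalIntegral.integral_const_mul] at hle
  have h5 : 0 ≤ ((m : ℝ) + 2) / S * f 0 := by positivity
  linarith

/-- The weak form of the damped wave inequality tested against `(1 - t / S) ^ (m + 2)`. -/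
theorem integral_source_le {u : ℝ → EuclideanSpace ℝ (Fin n) → ℝ}
    (hu : ContDiff ℝ 2 (fun z : ℝ × EuclideanSpace ℝ (Fin n) => u z.1 z.2))
    {w : ℝ × EuclideanSpace ℝ (Fin n) → ℝ} {δ S r : ℝ} (hδ : 0 ≤ δ) (hS : 0 < S)
    (hs : ∀ t ∈ Icc (0 : ℝ) S, ∀ x, r < ‖x‖ → u t x = 0)
    (heq : ∀ t ∈ Icc (0 : ℝ) S, ∀ x, deriv (deriv (fun s => u s x)) t - laplacian (u t) x
      + δ * deriv (fun s => u s x) t = w (t, x))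
    (h0 : ∀ x, 0 ≤ u 0 x) (m : ℕ) :
    (∫ z, w z * (1 - z.1 / S) ^ (m + 2) ∂cylinderMeasure n S r)
        + ∫ x in closedBall 0 r, (deriv (fun s => u s x) 0 + δ * u 0 x)
      ≤ ((m + 2) * (m + 1) / S ^ 2 + δ * (m + 2) / S)
        * ∫ z, |u z.1 z.2| * (1 - z.1 / S) ^ m ∂cylinderMeasure n S r := by
  set G := fun z : ℝ × EuclideanSpace ℝ (Fin n) => u z.1 z.2
  have cu : Continuous G := hu.continuous
  set G₁ := fun z : ℝ × EuclideanSpace ℝ (Fin n) => fderiv ℝ G z (1, 0)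
  have hC1 : ContDiff ℝ 1 G₁ :=
    (hu.fderiv_right (m := 1) (by norm_num)).clm_apply contDiff_const
  set G₂ := fun z : ℝ × EuclideanSpace ℝ (Fin n) => fderiv ℝ G₁ z (1, 0)
  have c₁ : Continuous G₁ := hC1.continuous
  have c₂ : Continuous G₂ := (hC1.continuous_fderiv one_ne_zero).clm_apply continuous_const
  have cL := continuous_laplacian_slice hu
  have d₁ : ∀ t x, HasDerivAt (fun s => u s x) (G₁ (t, x)) t := fun t x =>
    (hu.of_le (by norm_num)).hasDerivAt_slice_fst t x
  have d₂ : ∀ t x, HasDerivAt (fun s => G₁ (s, x)) (G₂ (t, x)) t := fun t x =>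
    hC1.hasDerivAt_slice_fst t x
  have e₁ : ∀ x, deriv (fun s => u s x) = fun s => G₁ (s, x) := fun x =>
    funext fun t => (d₁ t x).deriv
  simp only [e₁, (d₂ _ _).deriv] at heq ⊢
  have hlap : ∫ z, laplacian (u z.1) z.2 * (1 - z.1 / S) ^ (m + 2) ∂cylinderMeasure n S r = 0 := by
    have hi : Integrable (fun z : ℝ × EuclideanSpace ℝ (Fin n) =>
      laplacian (u z.1) z.2 * (1 - z.1 / S) ^ (m + 2)) (cylinderMeasure n S r) :=
        Continuous.integrable_cylinderMeasure (by fun_prop)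
    rw [cylinderMeasure] at hi ⊢
    rw [integral_prod _ hi]
    refine setIntegral_eq_zero_of_forall_eq_zero fun t ht => ?_
    have hut : ContDiff ℝ 2 (u t) := hu.comp (contDiff_const.prodMk contDiff_id)
    simp only [integral_mul_const, setIntegral_laplacian_eq_zero hut (hs t ht), zero_mul]
  have hsrc : ∫ z, w z * (1 - z.1 / S) ^ (m + 2) ∂cylinderMeasure n S r
      = ∫ z, (G₂ z + δ * G₁ z) * (1 - z.1 / S) ^ (m + 2) ∂cylinderMeasure n S r := by
    rw [← sub_zero (∫ z, (G₂ z + δ * G₁ z) * _ ∂_), ← hlap, ← integral_sub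
      (Continuous.integrable_cylinderMeasure (by fun_prop))
      (Continuous.integrable_cylinderMeasure (by fun_prop))]
    refine integral_congr_ae ?_
    filter_upwards [ae_cylinderMeasure_fst_mem n S r] with z hz
    have := heq z.1 hz z.2
    simp only [Prod.mk.eta] at this
    rw [← this]
    ring
  have i₁ : Integrable (fun z : ℝ × EuclideanSpace ℝ (Fin n) =>
      (G₂ z + δ * G₁ z) * (1 - z.1 / S) ^ (m + 2)) (cylinderMeasure n S r) :=
    Continuous.integrable_cylinderMeasure (by fun_prop)
  have i₂ : Integrable (fun z : ℝ × EuclideanSpace ℝ (Fin n) =>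
      |G z| * (1 - z.1 / S) ^ m) (cylinderMeasure n S r) :=
    Continuous.integrable_cylinderMeasure (by fun_prop)
  have i₃ : IntegrableOn (fun x => G₁ (0, x) + δ * G (0, x)) (closedBall 0 r) :=
    ContinuousOn.integrableOn_compact (isCompact_closedBall 0 r) (by fun_prop)
  rw [hsrc]
  change _ + ∫ x in closedBall 0 r, (G₁ (0, x) + δ * G (0, x))
    ≤ _ * ∫ z, |G z| * (1 - z.1 / S) ^ m ∂cylinderMeasure n S r
  rw [cylinderMeasure] at i₁ i₂ ⊢
  rw [integral_prod_symm _ i₁, integral_prod_symm _ i₂, ← integral_const_mul,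
    ← integral_add i₁.integral_prod_right i₃]
  refine integral_mono (i₁.integral_prod_right.add i₃) (i₂.integral_prod_right.const_mul _)
    fun x => ?_
  exact integral_mul_cutoff_le (fun t => d₁ t x) (fun t => d₂ t x) (by fun_prop) (h0 x) hδ hS m

/-- Hölder's inequality on the cylinder, with the cutoff absorbed. -/
theorem integral_abs_mul_cutoff_le {g : ℝ × EuclideanSpace ℝ (Fin n) → ℝ} (hg : Continuous g)
    {S r s : ℝ} (hS : 0 < S) (hs : 1 < s) {m : ℕ} (hm : 2 ≤ m * (s - 1)) :
    ∫ z, |g z| * (1 - z.1 / S) ^ m ∂cylinderMeasure n S r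
      ≤ (∫ z, |g z| ^ s * (1 - z.1 / S) ^ (m + 2) ∂cylinderMeasure n S r) ^ (1 / s)
        * (cylinderMeasure n S r).real univ ^ (1 - 1 / s) := by
  have hs0 : 0 < s := by linarith
  have hmem := ae_cylinderMeasure_fst_mem n S r
  have hτ : ∀ t ∈ Icc (0 : ℝ) S, 0 ≤ 1 - t / S ∧ 1 - t / S ≤ 1 := fun t ht =>
    ⟨by linarith [(div_le_one hS).2 ht.2], by linarith [div_nonneg ht.1 hS.le]⟩
  set a : ℝ := ((m : ℝ) + 2) / s with ha
  have ha0 : 0 < a := by positivity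
  have ham : a ≤ m := by rw [ha, div_le_iff₀ hs0]; linarith
  have cτ : Continuous fun z : ℝ × EuclideanSpace ℝ (Fin n) => (max (1 - z.1 / S) 0) ^ a :=
    Continuous.rpow_const (by fun_prop) fun _ => Or.inr ha0.le
  set F := fun z => |g z| * (max (1 - z.1 / S) 0) ^ a with hF
  have cF : Continuous F := hg.abs.mul cτ
  have hF0 : ∀ z, 0 ≤ F z := fun z => by positivity
  have hconj : s.HolderConjugate (s.conjExponent) := Real.HolderConjugate.conjExponent hs
  have hFp : ∀ᵐ z ∂cylinderMeasure n S r, F z ^ s = |g z| ^ s * (1 - z.1 / S) ^ (m + 2) := by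
    filter_upwards [hmem] with z hz
    obtain ⟨h1, -⟩ := hτ _ hz
    rw [hF]
    simp only [max_eq_left h1]
    rw [Real.mul_rpow (abs_nonneg _) (by positivity), ← Real.rpow_mul h1, ha,
      div_mul_cancel₀ _ hs0.ne', ← Real.rpow_natCast _ (m + 2)]
    push_cast
    rfl
  have cFp : Continuous fun z => ‖F z‖ ^ s :=
    cF.norm.rpow_const fun _ => Or.inr hs0.le
  have hmF : MemLp F (ENNReal.ofReal s) (cylinderMeasure n S r) := by
    rw [← integrable_norm_rpow_iff cF.aestronglyMeasurable (by simpa using hs0)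
      ENNReal.ofReal_ne_top, ENNReal.toReal_ofReal hs0.le]
    exact cFp.integrable_cylinderMeasure
  have hH := integral_mul_le_Lp_mul_Lq_of_nonneg (μ := cylinderMeasure n S r) hconj
    (f := F) (g := fun _ => 1) (ae_of_all _ hF0) (ae_of_all _ fun _ => zero_le_one) hmF
    (memLp_const 1)
  have hq : 1 / s.conjExponent = 1 - 1 / s := by
    have := hconj.inv_add_inv_eq_one
    simp only [one_div]
    linarith
  rw [integral_congr_ae hFp, hq] at hH
  simp only [mul_one, Real.one_rpow, integral_const, smul_eq_mul] at hH
  refine le_trans (integral_mono_ae (Continuous.integrable_cylinderMeasure (by fun_prop))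
    cF.integrable_cylinderMeasure ?_) hH
  filter_upwards [hmem] with z hz
  obtain ⟨h1, h2⟩ := hτ _ hz
  simp only [hF, max_eq_left h1]
  refine mul_le_mul_of_nonneg_left ?_ (abs_nonneg _)
  rw [← Real.rpow_natCast]
  exact Real.rpow_le_rpow_of_exponent_ge' h1 h2 ha0.le ham

end TestFunction

theorem le_rpow_of_coupled {A B y M N p q : ℝ} (hp : 1 < p) (hq : 1 < q) (hA : 0 ≤ A)
    (hB : 0 ≤ B) (hM : 0 < M) (hN : 0 < N) (hy : 0 < y) (hAB : A ≤ M * B ^ (1 / q))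
    (hBA : y + B ≤ N * A ^ (1 / p)) :
    y ≤ (N * M ^ (1 / p)) ^ (p * q / (p * q - 1)) := by
  have hp0 : 0 < p := by linarith
  have hq0 : 0 < q := by linarith
  have hpq : 0 < p * q - 1 := by nlinarith
  set D := N * M ^ (1 / p) with hD
  have hD0 : 0 < D := by positivity
  have h1 : y + B ≤ D * B ^ (1 / (p * q)) := by
    refine hBA.trans ?_
    rw [hD, mul_assoc]
    refine mul_le_mul_of_nonneg_left ?_ hN.le
    calc A ^ (1 / p) ≤ (M * B ^ (1 / q)) ^ (1 / p) :=
          Real.rpow_le_rpow hA hAB (by positivity)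
      _ = M ^ (1 / p) * B ^ (1 / (p * q)) := by
          rw [Real.mul_rpow hM.le (by positivity), ← Real.rpow_mul hB]
          congr 2
          field_simp
  set E := D ^ (p * q / (p * q - 1)) with hE
  have hDE : D * E ^ (1 / (p * q)) = E := by
    rw [hE, ← Real.rpow_mul hD0.le, ← Real.rpow_one_add' hD0.le]
    · congr 1
      field_simp
      ring
    · positivity
  rcases le_total B E with h | h
  · calc y ≤ D * B ^ (1 / (p * q)) := by linarith
      _ ≤ D * E ^ (1 / (p * q)) := by gcongr
      _ = E := hDE
  · exfalso
    have hE0 : 0 < E := by positivity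
    have hB0 : 0 < B := by linarith
    have hBs : B ^ (1 / (p * q)) * B ^ ((p * q - 1) / (p * q)) = B := by
      rw [← Real.rpow_add hB0, ← add_div, add_sub_cancel, div_self (by positivity),
        Real.rpow_one]
    have hDB : D ≤ B ^ ((p * q - 1) / (p * q)) := by
      calc D = E ^ ((p * q - 1) / (p * q)) := by
            rw [hE, ← Real.rpow_mul hD0.le]
            have : p * q / (p * q - 1) * ((p * q - 1) / (p * q)) = 1 := by field_simp
            rw [this, Real.rpow_one]
        _ ≤ _ := by gcongr
    have : D * B ^ (1 / (p * q)) ≤ B := by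
      calc _ ≤ B ^ ((p * q - 1) / (p * q)) * B ^ (1 / (p * q)) := by gcongr
        _ = B := by rw [mul_comm, hBs]
    linarith

theorem coupled_power_eq {k l S a b p q : ℝ} (hk : 0 < k) (hl : 0 < l) (hS : 0 < S) :
    (l * S ^ b * (k * S ^ a) ^ (1 / p)) ^ (p * q / (p * q - 1))
      = (l * k ^ (1 / p)) ^ (p * q / (p * q - 1)) * S ^ ((b + a / p) * (p * q / (p * q - 1))) := by
  rw [Real.mul_rpow hk.le (by positivity), ← Real.rpow_mul hS.le, Real.rpow_mul hS.le (b + a / p),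
    ← Real.mul_rpow (by positivity) (by positivity), Real.rpow_add hS, mul_one_div]
  congr 1
  ring

theorem mul_measure_rpow_le {s μ ω κ k S : ℝ} {n : ℕ} {j : ℝ} (hs : 1 < s) (hμ0 : 0 ≤ μ)
    (hω : 0 ≤ ω) (hS : 0 < S) (hμ : μ ≤ ω * S ^ (n + 1)) (hκ0 : 0 ≤ κ) (hκ : κ ≤ k * S ^ j) :
    κ * μ ^ (1 - 1 / s) ≤ k * ω ^ (1 - 1 / s) * S ^ (j + (n + 1) * (1 - 1 / s)) := by
  have h0 : 0 ≤ 1 - 1 / s := by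
    rw [sub_nonneg, div_le_one (by linarith)]
    exact hs.le
  have hkS : 0 ≤ k * S ^ j := hκ0.trans hκ
  calc κ * μ ^ (1 - 1 / s) ≤ (k * S ^ j) * (ω * S ^ (n + 1)) ^ (1 - 1 / s) := by gcongr
    _ = _ := by
      rw [Real.mul_rpow hω (by positivity), Real.rpow_add hS, Real.rpow_mul hS.le,
        ← Real.rpow_natCast S (n + 1)]
      push_cast
      ring

section Lifespan

open MeasureTheory Metric

variable {n : ℕ}

/-- The initial mass of either component is controlled by a negative power of the time up to
which the solution exists. -/
theorem exists_initial_mass_le (n : ℕ) {p q R : ℝ} (hp : 1 < p) (hq : 1 < q) (hR : 0 < R) :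
    ∃ K > (0 : ℝ), ∀ T S : ℝ, 1 ≤ S → S < T → ∀ u v : ℝ → EuclideanSpace ℝ (Fin n) → ℝ,
      IsNakaoSolution p q T u v → (∀ x, 0 ≤ u 0 x) → (∀ x, 0 ≤ v 0 x) →
      (∀ t ∈ Set.Ico (0 : ℝ) T, ∀ x, R + t < ‖x‖ → u t x = 0) →
      (∀ t ∈ Set.Ico (0 : ℝ) T, ∀ x, R + t < ‖x‖ → v t x = 0) →
      0 < ∫ x in closedBall 0 (R + S), (deriv (fun s => u s x) 0 + u 0 x) →
      0 < ∫ x in closedBall 0 (R + S), deriv (fun s => v s x) 0 →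
      (∫ x in closedBall 0 (R + S), (deriv (fun s => u s x) 0 + u 0 x))
          ≤ K * S ^ (-((1 + 2 * p) / (p * q - 1) - (n : ℝ))) ∧
        (∫ x in closedBall 0 (R + S), deriv (fun s => v s x) 0)
          ≤ K * S ^ (-((2 + q) / (p * q - 1) - (n : ℝ) + 1)) := by
  obtain ⟨m, hm⟩ := exists_nat_ge (max (2 / (p - 1)) (2 / (q - 1)))
  have hmp : 2 ≤ m * (p - 1) :=
    (div_le_iff₀ (by linarith)).1 ((le_max_left _ _).trans hm)
  have hmq : 2 ≤ m * (q - 1) :=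
    (div_le_iff₀ (by linarith)).1 ((le_max_right _ _).trans hm)
  have hp0 : 0 < p := by linarith
  have hq0 : 0 < q := by linarith
  have hpq : 0 < p * q - 1 := by nlinarith
  set ω := (1 + R) ^ n * volume.real (closedBall (0 : EuclideanSpace ℝ (Fin n)) 1)
  have hω0 : 0 < ω := by
    have : 0 < volume.real (closedBall (0 : EuclideanSpace ℝ (Fin n)) 1) :=
      ENNReal.toReal_pos (measure_closedBall_pos volume 0 one_pos).ne'
        measure_closedBall_lt_top.ne
    positivity
  set k : ℝ := 2 * ((m : ℝ) + 2) ^ 2 * ω ^ (1 - 1 / q)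
  set l : ℝ := ((m : ℝ) + 2) ^ 2 * ω ^ (1 - 1 / p)
  have hk0 : 0 < k := by positivity
  have hl0 : 0 < l := by positivity
  refine ⟨max ((k * l ^ (1 / q)) ^ (q * p / (q * p - 1)))
    ((l * k ^ (1 / p)) ^ (p * q / (p * q - 1))), by positivity, ?_⟩
  intro T S hS hST u v ⟨hu, hv, hequ, heqv⟩ hu0 hv0 hsu hsv hI hJ
  have hS0 : 0 < S := by linarith
  have hIco : ∀ t ∈ Icc (0 : ℝ) S, t ∈ Ico (0 : ℝ) T := fun t ht => ⟨ht.1, ht.2.trans_lt hST⟩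
  have hμ := cylinderMeasure_univ_le (n := n) hR hS
  set μ := cylinderMeasure n S (R + S)
  have hcut : ∀ (g : ℝ × EuclideanSpace ℝ (Fin n) → ℝ) (s : ℝ),
      0 ≤ ∫ z, |g z| ^ s * (1 - z.1 / S) ^ (m + 2) ∂μ := fun g s => by
    refine integral_nonneg_of_ae ?_
    filter_upwards [ae_cylinderMeasure_fst_mem n S (R + S)] with z hz
    have : 0 ≤ 1 - z.1 / S := by linarith [(div_le_one hS0).2 hz.2]
    simp only [Pi.zero_apply]
    positivity
  set A := ∫ z, |v z.1 z.2| ^ p * (1 - z.1 / S) ^ (m + 2) ∂μ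
  set B := ∫ z, |u z.1 z.2| ^ q * (1 - z.1 / S) ^ (m + 2) ∂μ
  have hA0 : 0 ≤ A := hcut (fun z => v z.1 z.2) p
  have hB0 : 0 ≤ B := hcut (fun z => u z.1 z.2) q
  have hfin : ∀ x, ∀ t ∈ Icc (0 : ℝ) S, R + S < ‖x‖ → R + t < ‖(x : EuclideanSpace ℝ (Fin n))‖ :=
    fun x t ht hx => by linarith [ht.2]
  have hu1 := integral_source_le hu zero_le_one hS0 (r := R + S)
    (fun t ht x hx => hsu t (hIco t ht) x (hfin x t ht hx))
    (w := fun z => |v z.1 z.2| ^ p)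
    (fun t ht x => by simpa using hequ t (hIco t ht) x)
    hu0 m
  have hv1 := integral_source_le hv le_rfl hS0 (r := R + S)
    (fun t ht x hx => hsv t (hIco t ht) x (hfin x t ht hx))
    (w := fun z => |u z.1 z.2| ^ q)
    (fun t ht x => by simpa using heqv t (hIco t ht) x)
    hv0 m
  simp only [one_mul, zero_mul, zero_div, add_zero] at hu1 hv1
  have hu2 := integral_abs_mul_cutoff_le (r := R + S) hu.continuous hS0 hq hmq
  have hv2 := integral_abs_mul_cutoff_le (r := R + S) hv.continuous hS0 hp hmp
  have hu3 : (∫ x in closedBall 0 (R + S), (deriv (fun s => u s x) 0 + u 0 x)) + A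
      ≤ (k * S ^ (-1 + ((n : ℝ) + 1) * (1 - 1 / q))) * B ^ (1 / q) := by
    have hκ : ((m : ℝ) + 2) * (m + 1) / S ^ 2 + (m + 2) / S
        ≤ 2 * ((m : ℝ) + 2) ^ 2 * S ^ (-1 : ℝ) := by
      rw [Real.rpow_neg_one, div_add_div _ _ (by positivity) hS0.ne', ← div_eq_mul_inv,
        div_le_div_iff₀ (by positivity) hS0]
      have : (0 : ℝ) ≤ m := m.cast_nonneg
      have hSS : S ^ 2 ≤ S ^ 3 := by nlinarith [sq_nonneg S]
      nlinarith [mul_nonneg this (sq_nonneg S), mul_nonneg this (sub_nonneg.2 hSS),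
        mul_nonneg (mul_nonneg this this) (sub_nonneg.2 hSS),
        mul_nonneg (mul_nonneg this this) (sq_nonneg S)]
    have := mul_measure_rpow_le hq (by positivity) hω0.le hS0 hμ (by positivity) hκ
    calc _ ≤ _ := by rw [add_comm]; exact hu1
      _ ≤ _ := mul_le_mul_of_nonneg_left hu2 (by positivity)
      _ = ((((m : ℝ) + 2) * (m + 1) / S ^ 2 + (m + 2) / S) * μ.real univ ^ (1 - 1 / q))
          * B ^ (1 / q) := by ring
      _ ≤ _ := mul_le_mul_of_nonneg_right this (by positivity)
  have hv3 : (∫ x in closedBall 0 (R + S), deriv (fun s => v s x) 0) + B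
      ≤ (l * S ^ (-2 + ((n : ℝ) + 1) * (1 - 1 / p))) * A ^ (1 / p) := by
    have hκ : ((m : ℝ) + 2) * (m + 1) / S ^ 2 ≤ ((m : ℝ) + 2) ^ 2 * S ^ (-2 : ℝ) := by
      rw [Real.rpow_neg hS0.le, Real.rpow_two, ← div_eq_mul_inv]
      have : (0 : ℝ) ≤ m := m.cast_nonneg
      gcongr
      nlinarith
    have := mul_measure_rpow_le hp (by positivity) hω0.le hS0 hμ (by positivity) hκ
    calc _ ≤ _ := by rw [add_comm]; exact hv1
      _ ≤ _ := mul_le_mul_of_nonneg_left hv2 (by positivity)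
      _ = (((m : ℝ) + 2) * (m + 1) / S ^ 2 * μ.real univ ^ (1 - 1 / p)) * A ^ (1 / p) := by ring
      _ ≤ _ := mul_le_mul_of_nonneg_right this (by positivity)
  constructor
  · have h := le_rpow_of_coupled hq hp hB0 hA0 (by positivity) (by positivity) hI
      (le_trans (by linarith) hv3) hu3
    rw [coupled_power_eq hl0 hk0 hS0] at h
    refine h.trans (mul_le_mul (le_max_left _ _) (le_of_eq ?_) (by positivity) (by positivity))
    congr 1
    have : q * p - 1 ≠ 0 := by linarith
    field_simp
    ring
  · have h := le_rpow_of_coupled hp hq hA0 hB0 (by positivity) (by positivity) hJ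
      (le_trans (by linarith) hu3) hv3
    rw [coupled_power_eq hk0 hl0 hS0] at h
    refine h.trans (mul_le_mul (le_max_right _ _) (le_of_eq ?_) (by positivity) (by positivity))
    congr 1
    field_simp
    ring

theorem integral_pos_of_continuous_of_support {f : EuclideanSpace ℝ (Fin n) → ℝ} {R : ℝ}
    (hc : Continuous f) (hn : ∀ x, 0 ≤ f x) (hs : ∀ x, R < ‖x‖ → f x = 0) (hne : f ≠ 0) :
    0 < ∫ x, f x := by
  obtain ⟨x, hx⟩ := Function.ne_iff.1 hne
  refine hc.integral_pos_of_hasCompactSupport_nonneg_nonzero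
    (HasCompactSupport.intro (isCompact_closedBall 0 R) fun y hy => hs y ?_) hn hx
  simpa using hy

theorem setIntegral_closedBall_eq_integral {f : EuclideanSpace ℝ (Fin n) → ℝ} {R r : ℝ}
    (hs : ∀ x, R < ‖x‖ → f x = 0) (hr : R ≤ r) :
    ∫ x in closedBall 0 r, f x = ∫ x, f x := by
  refine setIntegral_eq_integral_of_forall_compl_eq_zero fun x hx => hs x ?_
  rw [mem_closedBall_zero_iff, not_le] at hx
  linarith

end Lifespan

theorem le_mul_rpow_of_le_rpow_neg {ε K S F : ℝ} (hε : 0 < ε) (hK : 0 < K) (hS : 0 < S)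
    (hF : 0 < F) (h : ε ≤ K * S ^ (-F)) : S ≤ K ^ (1 / F) * ε ^ (-1 / F) := by
  have h1 : S ^ F ≤ K / ε := by
    rw [Real.rpow_neg hS.le, ← div_eq_mul_inv, le_div_iff₀ (by positivity)] at h
    rw [le_div_iff₀ hε]
    linarith
  calc S = (S ^ F) ^ (1 / F) := by
        rw [← Real.rpow_mul hS.le, mul_one_div_cancel hF.ne', Real.rpow_one]
    _ ≤ (K / ε) ^ (1 / F) := Real.rpow_le_rpow (by positivity) h1 (by positivity)
    _ = _ := by
      rw [Real.div_rpow hK.le hε.le, neg_div, Real.rpow_neg hε.le, div_eq_mul_inv]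

theorem nakao_blowup_prop2 {n : ℕ} (hn : 1 ≤ n) {p q : ℝ} (hp : 1 < p) (hq : 1 < q)
    (hpn : 3 ≤ n → p ≤ (n : ℝ) / ((n : ℝ) - 2)) (hqn : 3 ≤ n → q ≤ (n : ℝ) / ((n : ℝ) - 2))
    (hcond : max ((q / 2 + 1) / (p * q - 1)) ((1 / 2 + p) / (p * q - 1) - 1 / 2) > ((n : ℝ) - 1) / 2)
    {R : ℝ} (hR : 0 < R) (u₀ u₁ v₀ v₁ : EuclideanSpace ℝ (Fin n) → ℝ)
    (hu₀c : Continuous u₀) (hu₁c : Continuous u₁) (hv₀c : Continuous v₀) (hv₁c : Continuous v₁)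
    (hu₀n : ∀ x, 0 ≤ u₀ x) (hu₁n : ∀ x, 0 ≤ u₁ x) (hv₀n : ∀ x, 0 ≤ v₀ x) (hv₁n : ∀ x, 0 ≤ v₁ x)
    (hu₀s : ∀ x, R < ‖x‖ → u₀ x = 0) (hu₁s : ∀ x, R < ‖x‖ → u₁ x = 0)
    (hv₀s : ∀ x, R < ‖x‖ → v₀ x = 0) (hv₁s : ∀ x, R < ‖x‖ → v₁ x = 0)
    (hu₀ne : u₀ ≠ 0) (hv₁ne : v₁ ≠ 0) :
    ∃ ε₀ > (0:ℝ), ∃ C > (0:ℝ), ∀ ε : ℝ, 0 < ε → ε ≤ ε₀ → ∀ T > (0:ℝ),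
      ∀ u v : ℝ → EuclideanSpace ℝ (Fin n) → ℝ,
        IsNakaoSolution p q T u v →
        (∀ x, u 0 x = ε * u₀ x) → (∀ x, deriv (fun s => u s x) 0 = ε * u₁ x) →
        (∀ x, v 0 x = ε * v₀ x) → (∀ x, deriv (fun s => v s x) 0 = ε * v₁ x) →
        (∀ t ∈ Set.Ico (0:ℝ) T, ∀ x, R + t < ‖x‖ → u t x = 0) →
        (∀ t ∈ Set.Ico (0:ℝ) T, ∀ x, R + t < ‖x‖ → v t x = 0) →
        T ≤ C * ε ^ (-1 / max ((2 + q) / (p * q - 1) - (n : ℝ) + 1)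
                            ((1 + 2 * p) / (p * q - 1) - (n : ℝ))) := by
  set F₃ := (2 + q) / (p * q - 1) - (n : ℝ) + 1 with hF₃
  set F₄ := (1 + 2 * p) / (p * q - 1) - (n : ℝ) with hF₄
  have hF : 0 < max F₃ F₄ := by
    have e3 : F₃ = 2 * ((q / 2 + 1) / (p * q - 1) - ((n : ℝ) - 1) / 2) := by rw [hF₃]; ring
    have e4 : F₄ = 2 * ((1 / 2 + p) / (p * q - 1) - 1 / 2 - ((n : ℝ) - 1) / 2) := by
      rw [hF₄]; ring
    rcases lt_max_iff.1 hcond with h | h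
    · exact lt_max_of_lt_left (by linarith)
    · exact lt_max_of_lt_right (by linarith)
  obtain ⟨K, hK, hmass⟩ := exists_initial_mass_le n hp hq hR
  have hsum : ∀ x, R < ‖x‖ → u₁ x + u₀ x = 0 := fun x hx => by
    rw [hu₁s x hx, hu₀s x hx, add_zero]
  have hcu : 0 < ∫ x, (u₁ x + u₀ x) := by
    refine integral_pos_of_continuous_of_support (hu₁c.add hu₀c)
      (fun x => add_nonneg (hu₁n x) (hu₀n x)) hsum fun h => hu₀ne (funext fun x => ?_)
    have := congrFun h x
    simp only [Pi.zero_apply] at this ⊢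
    linarith [hu₀n x, hu₁n x]
  have hcv : 0 < ∫ x, v₁ x := integral_pos_of_continuous_of_support hv₁c hv₁n hv₁s hv₁ne
  set L := max (K / ∫ x, (u₁ x + u₀ x)) (K / ∫ x, v₁ x)
  have hL : 0 < L := lt_max_of_lt_left (by positivity)
  refine ⟨1, one_pos, max 1 (L ^ (1 / max F₃ F₄)), by positivity, ?_⟩
  intro ε hε hε1 T hT u v hsol hu0 hu1 hv0 hv1 hsu hsv
  have hεp : 0 < ε ^ (-1 / max F₃ F₄) := by positivity
  have hε_ge : 1 ≤ ε ^ (-1 / max F₃ F₄) :=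
    Real.one_le_rpow_of_pos_of_le_one_of_nonpos hε hε1
      (div_nonpos_of_nonpos_of_nonneg (by norm_num) hF.le)
  by_contra! hlt
  obtain ⟨S, hS1, hST⟩ := exists_between hlt
  have hS : 1 ≤ S := by
    have : (1 : ℝ) ≤ max 1 (L ^ (1 / max F₃ F₄)) := le_max_left _ _
    nlinarith
  have hS0 : 0 < S := by linarith
  have hI : ∫ x in Metric.closedBall 0 (R + S), (deriv (fun s => u s x) 0 + u 0 x)
      = ε * ∫ x, (u₁ x + u₀ x) := by
    rw [← setIntegral_closedBall_eq_integral hsum (by linarith : R ≤ R + S),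
      ← MeasureTheory.integral_const_mul]
    simp only [hu1, hu0, mul_add]
  have hJ : ∫ x in Metric.closedBall 0 (R + S), deriv (fun s => v s x) 0 = ε * ∫ x, v₁ x := by
    rw [← setIntegral_closedBall_eq_integral hv₁s (by linarith : R ≤ R + S),
      ← MeasureTheory.integral_const_mul]
    simp only [hv1]
  obtain ⟨h4, h3⟩ := hmass T S hS hST u v hsol
    (fun x => by rw [hu0]; exact mul_nonneg hε.le (hu₀n x))
    (fun x => by rw [hv0]; exact mul_nonneg hε.le (hv₀n x)) hsu hsv
    (by rw [hI]; positivity) (by rw [hJ]; positivity)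
  rw [hI, ← le_div_iff₀ hcu, mul_div_right_comm] at h4
  rw [hJ, ← le_div_iff₀ hcv, mul_div_right_comm] at h3
  have hmain : ε ≤ L * S ^ (-max F₃ F₄) := by
    rcases max_choice F₃ F₄ with h | h <;> rw [h]
    · exact h3.trans (mul_le_mul_of_nonneg_right (le_max_right _ _) (by positivity))
    · exact h4.trans (mul_le_mul_of_nonneg_right (le_max_left _ _) (by positivity))
  have hSle := le_mul_rpow_of_le_rpow_neg hε hL hS0 hF hmain
  have := mul_le_mul_of_nonneg_right (le_max_right 1 (L ^ (1 / max F₃ F₄))) hεp.le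
  linarith
end
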